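/- arXiv:math/0401382 — 2 statements merged into one kernel-verified Lean document; each statement's English description precedes it below -/
import Mathlib

section
/- For every n ≥ 1 and all real x: S_1(x;n) := P_n(x)²(x − α) − Q_n(x)²(x² − 1)(x − β) satisfies S_1(x;n) = 2 h_n · ( x + b_{n+1} − (α + β)/2 ). -/
open MeasureTheory Polynomial
open Filter Topology

/-- The weight of the two-band system with gap `(α, β)`. -/
noncomputable def bandWeight (α β x : ℝ) : ℝ :=
  (1 / Real.pi) * Real.sqrt ((x - α) / ((1 - x ^ 2) * (x - β)))

/-- The Möbius involution exchanging `-1 ↔ 1` and `α ↔ β`, hence the two bands. -/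
noncomputable def bandInvolution (α β x : ℝ) : ℝ :=
  ((α + β) - (1 + α * β) * x) / ((1 + α * β) - (α + β) * x)

/-- The function uniformizing the two bands. -/
noncomputable def bandRatio (α β x : ℝ) : ℝ := (1 - x ^ 2) / ((x - α) * (x - β))

section Bands

variable {α β : ℝ}

theorem bandInvolution_denom_pos (hα : -1 < α) (hαβ : α < β) (hβ : β < 1) {x : ℝ}
    (hx₁ : -1 ≤ x) (hx₂ : x ≤ 1) : 0 < (1 + α * β) - (α + β) * x := by
  nlinarith [mul_pos (by linarith : 0 < 1 + α) (by linarith : 0 < 1 + β),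
    mul_pos (by linarith : 0 < 1 - α) (by linarith : 0 < 1 - β),
    mul_nonneg (by linarith : 0 ≤ 1 - x)
      (mul_pos (by linarith : 0 < 1 + α) (by linarith : 0 < 1 + β)).le,
    mul_nonneg (by linarith : 0 ≤ 1 + x)
      (mul_pos (by linarith : 0 < 1 - α) (by linarith : 0 < 1 - β)).le]

theorem bandInvolution_sub_left {x : ℝ} (hD : (1 + α * β) - (α + β) * x ≠ 0) :
    bandInvolution α β x - α = (1 - α ^ 2) * (β - x) / ((1 + α * β) - (α + β) * x) := by
  rw [bandInvolution, eq_div_iff hD, sub_mul, div_mul_cancel₀ _ hD]; ring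

theorem bandInvolution_sub_right {x : ℝ} (hD : (1 + α * β) - (α + β) * x ≠ 0) :
    bandInvolution α β x - β = (1 - β ^ 2) * (α - x) / ((1 + α * β) - (α + β) * x) := by
  rw [bandInvolution, eq_div_iff hD, sub_mul, div_mul_cancel₀ _ hD]; ring

theorem one_sub_bandInvolution {x : ℝ} (hD : (1 + α * β) - (α + β) * x ≠ 0) :
    1 - bandInvolution α β x = (1 - α) * (1 - β) * (1 + x) / ((1 + α * β) - (α + β) * x) := by
  rw [bandInvolution, eq_div_iff hD, sub_mul, div_mul_cancel₀ _ hD]; ring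

theorem one_add_bandInvolution {x : ℝ} (hD : (1 + α * β) - (α + β) * x ≠ 0) :
    1 + bandInvolution α β x = (1 + α) * (1 + β) * (1 - x) / ((1 + α * β) - (α + β) * x) := by
  rw [bandInvolution, eq_div_iff hD, add_mul, div_mul_cancel₀ _ hD]; ring

theorem bandInvolution_bandInvolution (hα : -1 < α) (hαβ : α < β) (hβ : β < 1) {x : ℝ}
    (hD : (1 + α * β) - (α + β) * x ≠ 0) :
    bandInvolution α β (bandInvolution α β x) = x := by
  have h1 : 0 < (1 - α ^ 2) * (1 - β ^ 2) :=
    mul_pos (by nlinarith) (by nlinarith)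
  have hD' : (1 + α * β) - (α + β) * bandInvolution α β x =
      (1 - α ^ 2) * (1 - β ^ 2) / ((1 + α * β) - (α + β) * x) := by
    rw [bandInvolution, eq_div_iff hD, sub_mul, mul_assoc (α + β), div_mul_cancel₀ _ hD]; ring
  have hD'' : (1 + α * β) - (α + β) * bandInvolution α β x ≠ 0 := by
    rw [hD']; exact div_ne_zero h1.ne' hD
  rw [bandInvolution, div_eq_iff hD'', hD', bandInvolution]
  field_simp
  ring

theorem hasDerivAt_bandInvolution {x : ℝ} (hD : (1 + α * β) - (α + β) * x ≠ 0) :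
    HasDerivAt (bandInvolution α β)
      (-((1 - α ^ 2) * (1 - β ^ 2) / ((1 + α * β) - (α + β) * x) ^ 2)) x := by
  have h1 : HasDerivAt (fun x : ℝ => (α + β) - (1 + α * β) * x) (-(1 + α * β)) x := by
    simpa using ((hasDerivAt_id x).const_mul (1 + α * β)).const_sub (α + β)
  have h2 : HasDerivAt (fun x : ℝ => (1 + α * β) - (α + β) * x) (-(α + β)) x := by
    simpa using ((hasDerivAt_id x).const_mul (α + β)).const_sub (1 + α * β)
  refine (h1.div h2 hD).congr_deriv ?_
  rw [← neg_div]; congr 1; ring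

theorem bandInvolution_image (hα : -1 < α) (hαβ : α < β) (hβ : β < 1) :
    bandInvolution α β '' Set.Ioo (-1) α = Set.Ioo β 1 := by
  have a1 : 0 < 1 - α ^ 2 := by nlinarith
  have b1 : 0 < 1 - β ^ 2 := by nlinarith
  ext y
  constructor
  · rintro ⟨x, ⟨hx1, hx2⟩, rfl⟩
    have hD := bandInvolution_denom_pos hα hαβ hβ hx1.le (by linarith)
    constructor
    · rw [← sub_pos, bandInvolution_sub_right hD.ne']
      exact div_pos (mul_pos b1 (by linarith)) hD
    · rw [← sub_pos, one_sub_bandInvolution hD.ne']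
      exact div_pos (mul_pos (mul_pos (by linarith) (by linarith)) (by linarith)) hD
  · rintro ⟨hx1, hx2⟩
    have hD := bandInvolution_denom_pos hα hαβ hβ (by linarith : -1 ≤ y) hx2.le
    refine ⟨_, ⟨?_, ?_⟩, bandInvolution_bandInvolution hα hαβ hβ hD.ne'⟩
    · rw [← sub_pos, sub_neg_eq_add, add_comm, one_add_bandInvolution hD.ne']
      exact div_pos (mul_pos (mul_pos (by linarith) (by linarith)) (by linarith)) hD
    · rw [← sub_neg, bandInvolution_sub_left hD.ne']
      exact div_neg_of_neg_of_pos (mul_neg_of_pos_of_neg a1 (by linarith)) hD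

theorem bandRatio_pos (hαβ : α < β) (hβ : β < 1) {x : ℝ}
    (hx : x ∈ Set.Ioo (-1) α) : 0 < bandRatio α β x := by
  have := hx.1
  have := hx.2
  exact div_pos (by nlinarith) (mul_pos_of_neg_of_neg (by linarith) (by linarith))

theorem bandWeight_left (hαβ : α < β) (hβ : β < 1) {x : ℝ}
    (hx : x ∈ Set.Ioo (-1) α) :
    bandWeight α β x =
      (1 / Real.pi) * (Real.sqrt (bandRatio α β x) * ((α - x) / (1 - x ^ 2))) := by
  obtain ⟨h1, h2⟩ := hx
  have h3 : 0 < 1 - x ^ 2 := by nlinarith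
  have h4 : 0 < (α - x) / (1 - x ^ 2) := div_pos (by linarith) h3
  have h5 : x - α ≠ 0 := by linarith
  have h6 : x - β ≠ 0 := by linarith
  rw [bandWeight, ← Real.sqrt_sq h4.le, ← Real.sqrt_mul' _ (sq_nonneg _), bandRatio]
  congr 2
  field_simp
  ring

theorem bandWeight_bandInvolution (hα : -1 < α) (hαβ : α < β) (hβ : β < 1) {x : ℝ}
    (hx : x ∈ Set.Ioo (-1) α) :
    (1 - α ^ 2) * (1 - β ^ 2) / ((1 + α * β) - (α + β) * x) ^ 2 *
        bandWeight α β (bandInvolution α β x) =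
      (1 / Real.pi) * (Real.sqrt (bandRatio α β x) *
        ((1 - α ^ 2) * (β - x) / ((1 - x ^ 2) * ((1 + α * β) - (α + β) * x)))) := by
  obtain ⟨h1, h2⟩ := hx
  have h3 : 0 < 1 - x ^ 2 := by nlinarith
  have h5 : x - α ≠ 0 := by linarith
  have h6 : x - β ≠ 0 := by linarith
  have a1 : 0 < 1 - α ^ 2 := by nlinarith
  have b1 : 0 < 1 - β ^ 2 := by nlinarith
  have hD := bandInvolution_denom_pos hα hαβ hβ h1.le (by linarith)
  have e1 : 0 < (1 - α ^ 2) * (β - x) / ((1 - x ^ 2) * ((1 + α * β) - (α + β) * x)) :=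
    div_pos (mul_pos a1 (by linarith)) (mul_pos h3 hD)
  have e2 : 0 < (1 - α ^ 2) * (1 - β ^ 2) / ((1 + α * β) - (α + β) * x) ^ 2 :=
    div_pos (mul_pos a1 b1) (by positivity)
  have e3 : 1 - bandInvolution α β x ^ 2 = (1 - α ^ 2) * (1 - β ^ 2) * (1 - x ^ 2) /
      ((1 + α * β) - (α + β) * x) ^ 2 := by
    rw [show 1 - bandInvolution α β x ^ 2 =
      (1 - bandInvolution α β x) * (1 + bandInvolution α β x) by ring,
      one_sub_bandInvolution hD.ne', one_add_bandInvolution hD.ne']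
    field_simp
    ring
  rw [bandWeight, mul_left_comm, ← Real.sqrt_sq e1.le, ← Real.sqrt_mul' _ (sq_nonneg _)]
  conv_lhs => rw [← Real.sqrt_sq e2.le, ← Real.sqrt_mul (sq_nonneg _)]
  congr 2
  rw [e3, bandInvolution_sub_left hD.ne', bandInvolution_sub_right hD.ne', bandRatio]
  have h7 : α - x ≠ 0 := by linarith
  generalize hDD : (1 + α * β) - (α + β) * x = D at *
  have := hD.ne'
  field_simp
  ring


theorem hasDerivAt_bandRatio {x : ℝ} (h1 : x ≠ α) (h2 : x ≠ β) :
    HasDerivAt (bandRatio α β)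
      ((-(2 * x) * ((x - α) * (x - β)) - (1 - x ^ 2) * (2 * x - α - β)) /
        ((x - α) * (x - β)) ^ 2) x := by
  have h3 : HasDerivAt (fun x : ℝ => 1 - x ^ 2) (-(2 * x)) x := by
    simpa using ((hasDerivAt_id x).pow 2).const_sub 1
  have h4 : HasDerivAt (fun x : ℝ => (x - α) * (x - β)) (2 * x - α - β) x :=
    (((hasDerivAt_id x).sub_const α).mul ((hasDerivAt_id x).sub_const β)).congr_deriv
      (by simp; ring)
  exact h3.div h4 (mul_ne_zero (sub_ne_zero.2 h1) (sub_ne_zero.2 h2))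

/-- An antiderivative, on the left band, of the two-band Cauchy kernel folded by the involution. -/
noncomputable def bandPrimitive (α β z x : ℝ) : ℝ :=
  (2 / Real.pi) * ((z - α) / Real.sqrt ((z ^ 2 - 1) * (z - α) * (z - β))) *
    Real.arctan (Real.sqrt ((z ^ 2 - 1) * (z - α) * (z - β)) / (z ^ 2 - 1) *
      Real.sqrt (bandRatio α β x))

theorem hasDerivAt_bandPrimitive (hα : -1 < α) (hαβ : α < β) (hβ : β < 1) {z x : ℝ} (hz : 1 < z)
    (hx : x ∈ Set.Ioo (-1) α) :
    HasDerivAt (bandPrimitive α β z)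
      (bandWeight α β x / (z - x) +
        |-((1 - α ^ 2) * (1 - β ^ 2) / ((1 + α * β) - (α + β) * x) ^ 2)| *
          (bandWeight α β (bandInvolution α β x) / (z - bandInvolution α β x))) x := by
  have hq := bandRatio_pos hαβ hβ hx
  have hs := Real.sqrt_pos.2 hq
  have hW : 0 < (z ^ 2 - 1) * (z - α) * (z - β) :=
    mul_pos (mul_pos (by nlinarith) (by linarith)) (by linarith)
  have hr := Real.sqrt_pos.2 hW
  have a1 : 0 < 1 - α ^ 2 := by nlinarith
  have b1 : 0 < 1 - β ^ 2 := by nlinarith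
  have hD := bandInvolution_denom_pos hα hαβ hβ hx.1.le (by linarith [hx.2])
  have e2 : 0 < (1 - α ^ 2) * (1 - β ^ 2) / ((1 + α * β) - (α + β) * x) ^ 2 :=
    div_pos (mul_pos a1 b1) (by positivity)
  have key := ((((hasDerivAt_bandRatio (α := α) (β := β) hx.2.ne
    (hx.2.trans hαβ).ne).sqrt hq.ne').const_mul
    (Real.sqrt ((z ^ 2 - 1) * (z - α) * (z - β)) / (z ^ 2 - 1))).arctan).const_mul
    ((2 / Real.pi) * ((z - α) / Real.sqrt ((z ^ 2 - 1) * (z - α) * (z - β))))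
  refine key.congr_deriv ?_
  rw [abs_neg, abs_of_pos e2,
    ← mul_div_assoc _ (bandWeight α β (bandInvolution α β x)), bandWeight_bandInvolution hα hαβ hβ hx,
    bandWeight_left hαβ hβ hx, mul_pow, div_pow, Real.sq_sqrt hW.le, Real.sq_sqrt hq.le]
  have hσ : z - bandInvolution α β x =
      (z * ((1 + α * β) - (α + β) * x) + ((1 + α * β) * x - (α + β))) /
        ((1 + α * β) - (α + β) * x) := by
    rw [bandInvolution, eq_div_iff hD.ne', sub_mul, div_mul_cancel₀ _ hD.ne']; ring
  have hσ0 : 0 < z - bandInvolution α β x := by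
    have : bandInvolution α β x ∈ Set.Ioo β 1 :=
      bandInvolution_image hα hαβ hβ ▸ Set.mem_image_of_mem _ hx
    linarith [this.2]
  rw [hσ] at hσ0
  have hN : 0 < z * ((1 + α * β) - (α + β) * x) + ((1 + α * β) * x - (α + β)) := by
    simpa [hD] using (div_pos_iff_of_pos_right hD).1 hσ0
  rw [hσ]
  have hzx : 0 < z - x := by linarith [hx.2]
  have hz2 : 0 < z ^ 2 - 1 := by nlinarith
  have hx2 : 0 < 1 - x ^ 2 := by nlinarith [hx.1, hx.2]
  have hA : 0 < (x - α) * (x - β) :=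
    mul_pos_of_neg_of_neg (by linarith [hx.2]) (by linarith [hx.2])
  have hden : 1 + (z ^ 2 - 1) * (z - α) * (z - β) / (z ^ 2 - 1) ^ 2 * bandRatio α β x =
      (z - x) * (z * ((1 + α * β) - (α + β) * x) + ((1 + α * β) * x - (α + β))) /
        ((z ^ 2 - 1) * ((x - α) * (x - β))) := by
    rw [bandRatio, eq_div_iff (mul_pos hz2 hA).ne']
    generalize hA' : (x - α) * (x - β) = A at *
    field_simp
    rw [← hA']
    ring
  have hinv : ((-(2 * x) * ((x - α) * (x - β)) - (1 - x ^ 2) * (2 * x - α - β)) /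
      ((x - α) * (x - β)) ^ 2 / (2 * Real.sqrt (bandRatio α β x))) =
      Real.sqrt (bandRatio α β x) / 2 *
      ((-(2 * x) * ((x - α) * (x - β)) - (1 - x ^ 2) * (2 * x - α - β)) /
      ((1 - x ^ 2) * ((x - α) * (x - β)))) := by
    have hsq : Real.sqrt (bandRatio α β x) ^ 2 = (1 - x ^ 2) / ((x - α) * (x - β)) :=
      Real.sq_sqrt hq.le
    generalize Real.sqrt (bandRatio α β x) = s at *
    generalize (x - α) * (x - β) = A at *
    generalize -(2 * x) * A - (1 - x ^ 2) * (2 * x - α - β) = N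
    field_simp at hsq ⊢
    linear_combination -N * hsq
  have hnum : (z - α) * (-(2 * x) * ((x - α) * (x - β)) - (1 - x ^ 2) * (2 * x - α - β)) =
      (α - x) * (z * ((1 + α * β) - (α + β) * x) + ((1 + α * β) * x - (α + β))) +
      (1 - α ^ 2) * (β - x) * (z - x) := by ring
  rw [hden, hinv]
  generalize -(2 * x) * ((x - α) * (x - β)) - (1 - x ^ 2) * (2 * x - α - β) = N at *
  generalize (x - α) * (x - β) = A at *
  generalize z * ((1 + α * β) - (α + β) * x) + ((1 + α * β) * x - (α + β)) = M at *
  generalize (1 + α * β) - (α + β) * x = D at *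
  generalize Real.sqrt (bandRatio α β x) = s at *
  generalize Real.sqrt ((z ^ 2 - 1) * (z - α) * (z - β)) = r at *
  field_simp
  linear_combination hnum

theorem integral_cauchy_bandWeight (hα : -1 < α) (hαβ : α < β) (hβ : β < 1)
    (hint : IntegrableOn (bandWeight α β) (Set.Icc (-1) α ∪ Set.Icc β 1)) {z : ℝ} (hz : 1 < z) :
    ∫ t in Set.Icc (-1) α ∪ Set.Icc β 1, bandWeight α β t / (z - t) =
      (z - α) / Real.sqrt ((z ^ 2 - 1) * (z - α) * (z - β)) := by
  have hint' : IntegrableOn (fun t => bandWeight α β t / (z - t))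
      (Set.Icc (-1) α ∪ Set.Icc β 1) := by
    have hc : ContinuousOn (fun t : ℝ => (z - t)⁻¹) (Set.Icc (-1) α ∪ Set.Icc β 1) := by
      refine ContinuousOn.inv₀ (by fun_prop) ?_
      rintro t (ht | ht) <;> linarith [ht.2]
    refine (hint.continuousOn_mul hc (isCompact_Icc.union isCompact_Icc)).congr_fun ?_
      (measurableSet_Icc.union measurableSet_Icc)
    intro t _
    simp only [div_eq_mul_inv, mul_comm]
  have hD : ∀ x ∈ Set.Ioo (-1) α, (1 + α * β) - (α + β) * x ≠ 0 := fun x hx =>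
    (bandInvolution_denom_pos hα hαβ hβ hx.1.le (by linarith [hx.2])).ne'
  have hderiv : ∀ x ∈ Set.Ioo (-1) α, HasDerivWithinAt (bandInvolution α β)
      (-((1 - α ^ 2) * (1 - β ^ 2) / ((1 + α * β) - (α + β) * x) ^ 2)) (Set.Ioo (-1) α) x :=
    fun x hx => (hasDerivAt_bandInvolution (hD x hx)).hasDerivWithinAt
  have hinj : Set.InjOn (bandInvolution α β) (Set.Ioo (-1) α) := by
    intro x hx y hy hxy
    rw [← bandInvolution_bandInvolution hα hαβ hβ (hD x hx), hxy,
      bandInvolution_bandInvolution hα hαβ hβ (hD y hy)]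
  have hl : IntegrableOn (fun t => bandWeight α β t / (z - t)) (Set.Ioo (-1) α) :=
    hint'.mono_set (Set.Ioo_subset_Icc_self.trans Set.subset_union_left)
  have hr : IntegrableOn (fun t => bandWeight α β t / (z - t)) (Set.Ioo β 1) :=
    hint'.mono_set (Set.Ioo_subset_Icc_self.trans Set.subset_union_right)
  have hr' := hr
  rw [← bandInvolution_image hα hαβ hβ,
    integrableOn_image_iff_integrableOn_abs_deriv_smul measurableSet_Ioo hderiv hinj] at hr'
  rw [setIntegral_union _ measurableSet_Icc (hint'.mono_set Set.subset_union_left)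
    (hint'.mono_set Set.subset_union_right), integral_Icc_eq_integral_Ioo,
    integral_Icc_eq_integral_Ioo, ← bandInvolution_image hα hαβ hβ,
    integral_image_eq_integral_abs_deriv_smul measurableSet_Ioo hderiv hinj,
    ← integral_add hl hr', ← integral_Ioc_eq_integral_Ioo, ← intervalIntegral.integral_of_le hα.le]
  · have hz2 : 0 < z ^ 2 - 1 := by nlinarith
    have hW : 0 < (z ^ 2 - 1) * (z - α) * (z - β) :=
      mul_pos (mul_pos hz2 (by linarith)) (by linarith)
    have hk : 0 < Real.sqrt ((z ^ 2 - 1) * (z - α) * (z - β)) / (z ^ 2 - 1) :=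
      div_pos (Real.sqrt_pos.2 hW) hz2
    have t1 : Tendsto (bandPrimitive α β z) (𝓝[>] (-1)) (𝓝 0) := by
      have h0 : bandPrimitive α β z (-1) = 0 := by simp [bandPrimitive, bandRatio]
      have hc : ContinuousAt (bandPrimitive α β z) (-1) := by
        have : ContinuousAt (bandRatio α β) (-1) :=
          (hasDerivAt_bandRatio hα.ne (hα.trans hαβ).ne).continuousAt
        unfold bandPrimitive
        fun_prop
      rw [← h0]
      exact hc.tendsto.mono_left nhdsWithin_le_nhds
    have t2 : Tendsto (bandPrimitive α β z) (𝓝[<] α)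
        (𝓝 ((z - α) / Real.sqrt ((z ^ 2 - 1) * (z - α) * (z - β)))) := by
      have hq : Tendsto (bandRatio α β) (𝓝[<] α) atTop := by
        have hc : Tendsto (fun x : ℝ => (1 - x ^ 2) / (β - x)) (𝓝[<] α)
            (𝓝 ((1 - α ^ 2) / (β - α))) := by
          refine Tendsto.mono_left (ContinuousAt.tendsto ?_) nhdsWithin_le_nhds
          exact ContinuousAt.div (by fun_prop) (by fun_prop) (by linarith)
        have hi : Tendsto (fun x : ℝ => (α - x)⁻¹) (𝓝[<] α) atTop := by
          refine tendsto_inv_nhdsGT_zero.comp (tendsto_nhdsWithin_iff.2 ⟨?_, ?_⟩)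
          · refine Tendsto.mono_left ?_ nhdsWithin_le_nhds
            have : ContinuousAt (fun x : ℝ => α - x) α := by fun_prop
            simpa using this.tendsto
          · filter_upwards [self_mem_nhdsWithin] with x hx
            simpa using hx
        refine (hc.pos_mul_atTop (div_pos (by nlinarith) (by linarith)) hi).congr fun x => ?_
        rw [bandRatio, ← div_eq_mul_inv, div_div]
        congr 1
        ring
      have ht := (Real.tendsto_arctan_atTop.mono_right nhdsWithin_le_nhds).comp
        ((Real.tendsto_sqrt_atTop.comp hq).const_mul_atTop hk)
      have := ht.const_mul
        ((2 / Real.pi) * ((z - α) / Real.sqrt ((z ^ 2 - 1) * (z - α) * (z - β))))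
      have hpi : (2 / Real.pi) * ((z - α) / Real.sqrt ((z ^ 2 - 1) * (z - α) * (z - β))) *
          (Real.pi / 2) = (z - α) / Real.sqrt ((z ^ 2 - 1) * (z - α) * (z - β)) := by
        rw [mul_right_comm, div_mul_div_cancel₀ Real.pi_ne_zero, div_self two_ne_zero, one_mul]
      rwa [hpi] at this
    simp only [smul_eq_mul] at hr' ⊢
    rw [intervalIntegral.integral_eq_sub_of_hasDerivAt_of_tendsto hα
      (fun x hx => hasDerivAt_bandPrimitive hα hαβ hβ hz hx) _ t1 t2, sub_zero]
    rw [intervalIntegrable_iff_integrableOn_Ioo_of_le hα.le]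
    exact hl.add hr'
  · rw [Set.disjoint_left]
    intro x hx hx'
    linarith [hx.2, hx'.1]

end Bands

theorem integral_mul_eq_zero_of_degree_lt {E : Set ℝ} {w : ℝ → ℝ} {P : ℕ → Polynomial ℝ}
    (hPmonic : ∀ n, (P n).Monic) (hPdeg : ∀ n, (P n).natDegree = n)
    (hint : ∀ q : Polynomial ℝ, IntegrableOn (fun t => q.eval t * w t) E)
    (horth : ∀ n m, n ≠ m → ∫ t in E, (P n).eval t * (P m).eval t * w t = 0)
    {n d : ℕ} (hd : d ≤ n) {q : Polynomial ℝ} (hq : q.degree < d) :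
    ∫ t in E, q.eval t * (P n).eval t * w t = 0 := by
  induction d generalizing q with
  | zero =>
    have : q = 0 := by simpa using hq
    simp [this]
  | succ d ih =>
    have hdeg : (P d).degree = d := by
      rw [degree_eq_natDegree (hPmonic d).ne_zero, hPdeg]
    have hr : (q - C (q.coeff d) * P d).degree < d := by
      rw [degree_lt_iff_coeff_zero]
      intro m hm
      rcases hm.eq_or_lt with rfl | hm
      · have : (P d).coeff d = 1 := by
          simpa [Monic, leadingCoeff, hPdeg] using hPmonic d
        simp [this]
      · rw [coeff_sub, coeff_C_mul, coeff_eq_zero_of_degree_lt (hq.trans_le (by exact_mod_cast hm)),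
          coeff_eq_zero_of_degree_lt (hdeg.trans_lt (by exact_mod_cast hm)), mul_zero, sub_zero]
    have h1 := ih (by omega) hr
    have h2 := horth d n (by omega)
    have i1 : IntegrableOn
        (fun t => (q - C (q.coeff d) * P d).eval t * (P n).eval t * w t) E := by
      simpa only [eval_mul] using hint ((q - C (q.coeff d) * P d) * P n)
    have i2 : IntegrableOn (fun t => (P d).eval t * (P n).eval t * w t) E := by
      simpa only [eval_mul] using hint (P d * P n)
    calc ∫ t in E, q.eval t * (P n).eval t * w t
        = ∫ t in E, ((q - C (q.coeff d) * P d).eval t * (P n).eval t * w t +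
            q.coeff d * ((P d).eval t * (P n).eval t * w t)) := by
          congr 1; ext t; simp only [eval_sub, eval_mul, eval_C]; ring
      _ = 0 := by
          rw [integral_add i1 (i2.const_mul _), integral_const_mul, h1, h2, mul_zero, add_zero]

theorem integrableOn_mul_cauchy {E : Set ℝ} (hE : IsCompact E) (hE1 : E ⊆ Set.Icc (-1) 1)
    {u : ℝ → ℝ} (hu : IntegrableOn u E) {z : ℝ} (hz : 1 < z) {f : ℝ → ℝ} (hf : ContinuousOn f E) :
    IntegrableOn (fun t => f t / (z - t) * u t) E :=
  hu.continuousOn_mul (hf.div (by fun_prop) fun t ht => by linarith [(hE1 ht).2]) hE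

theorem tendsto_cauchy_second_moment {E : Set ℝ} (hE : IsCompact E) (hE1 : E ⊆ Set.Icc (-1) 1)
    {u : ℝ → ℝ} (hu : IntegrableOn u E) :
    Tendsto (fun z : ℝ => z ^ 2 * (∫ t in E, 1 / (z - t) * u t) - z * ∫ t in E, u t) atTop
      (𝓝 (∫ t in E, t * u t)) := by
  have hm := hE.measurableSet
  have hid : IntegrableOn (fun t => t * u t) E := hu.continuousOn_mul continuousOn_id hE
  have hrem : Tendsto (fun z : ℝ => ∫ t in E, t ^ 2 / (z - t) * u t) atTop (𝓝 0) := by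
    have hlim : Tendsto (fun z : ℝ => (z - 1)⁻¹ * ∫ t in E, |u t|) atTop (𝓝 0) := by
      simpa [sub_eq_add_neg] using (tendsto_inv_atTop_zero.comp
        (tendsto_atTop_add_const_right _ (-1 : ℝ) tendsto_id)).mul_const (∫ t in E, |u t|)
    refine squeeze_zero_norm' ?_ hlim
    filter_upwards [eventually_gt_atTop 1] with z hz
    rw [← integral_const_mul]
    refine norm_integral_le_of_norm_le (hu.abs.const_mul _) ?_
    filter_upwards [ae_restrict_mem hm] with t ht
    obtain ⟨h1, h2⟩ := hE1 ht
    rw [norm_mul, Real.norm_eq_abs, Real.norm_eq_abs]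
    refine mul_le_mul_of_nonneg_right ?_ (abs_nonneg _)
    rw [abs_of_nonneg (div_nonneg (sq_nonneg t) (by linarith)), ← one_div]
    exact div_le_div₀ zero_le_one (by nlinarith) (by linarith) (by linarith)
  have hsum := hrem.const_add (∫ t in E, t * u t)
  rw [add_zero] at hsum
  refine hsum.congr' ?_
  filter_upwards [eventually_gt_atTop 1] with z hz
  have i1 := integrableOn_mul_cauchy hE hE1 hu hz (f := fun t => t ^ 2) (by fun_prop)
  have i2 := integrableOn_mul_cauchy hE hE1 hu hz (f := fun _ => 1) (by fun_prop)
  rw [← integral_const_mul, ← integral_const_mul, ← integral_add hid i1,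
    ← integral_sub (i2.const_mul _) (hu.const_mul _)]
  refine setIntegral_congr_fun hm fun t ht => ?_
  have : z - t ≠ 0 := by linarith [(hE1 ht).2]
  field_simp
  ring

theorem tendsto_sqrt_quartic_div_sq (α β : ℝ) :
    Tendsto (fun z : ℝ => Real.sqrt ((z ^ 2 - 1) * (z - α) * (z - β)) / z ^ 2) atTop (𝓝 1) := by
  have hi := tendsto_inv_atTop_zero (𝕜 := ℝ)
  have h : Tendsto (fun z : ℝ => (1 - z⁻¹ ^ 2) * (1 - α * z⁻¹) * (1 - β * z⁻¹)) atTop (𝓝 1) := by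
    simpa using ((hi.pow 2).const_sub 1).mul ((hi.const_mul α).const_sub 1) |>.mul
      ((hi.const_mul β).const_sub 1)
  have h' := (Real.continuous_sqrt.tendsto 1).comp h
  rw [Real.sqrt_one] at h'
  refine h'.congr' ?_
  filter_upwards [eventually_gt_atTop 0] with z hz
  rw [eq_div_iff (by positivity), Function.comp_apply]
  rw [← Real.sqrt_sq (sq_nonneg z), ← Real.sqrt_mul' _ (by positivity), Real.sqrt_sq (sq_nonneg z)]
  congr 1
  field_simp

theorem tendsto_sqrt_quartic_sub (α β : ℝ) :
    Tendsto (fun z : ℝ => Real.sqrt ((z ^ 2 - 1) * (z - α) * (z - β)) / z - z) atTop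
      (𝓝 (-((α + β) / 2))) := by
  have hi := tendsto_inv_atTop_zero (𝕜 := ℝ)
  have hn : Tendsto (fun z : ℝ => -(α + β) + (α * β - 1) * z⁻¹ + (α + β) * z⁻¹ ^ 2 -
      α * β * z⁻¹ ^ 3) atTop (𝓝 (-(α + β))) := by
    simpa using (((hi.const_mul (α * β - 1)).const_add (-(α + β))).add
      ((hi.pow 2).const_mul (α + β))).sub ((hi.pow 3).const_mul (α * β))
  have h := hn.div ((tendsto_sqrt_quartic_div_sq α β).add_const 1) (by norm_num)
  rw [show -(α + β) / (1 + 1) = -((α + β) / 2) by ring] at h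
  refine h.congr' ?_
  filter_upwards [eventually_gt_atTop (max 1 (max α β))] with z hz
  simp only [max_lt_iff] at hz
  obtain ⟨h1, h2, h3⟩ := hz
  have hW : 0 ≤ (z ^ 2 - 1) * (z - α) * (z - β) :=
    mul_nonneg (mul_nonneg (by nlinarith) (by linarith)) (by linarith)
  rw [Pi.div_apply]
  have hsq := Real.sq_sqrt hW
  have hr := Real.sqrt_nonneg ((z ^ 2 - 1) * (z - α) * (z - β))
  generalize Real.sqrt ((z ^ 2 - 1) * (z - α) * (z - β)) = r at *
  have hz0 : 0 < z := by linarith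
  have hd : r / z ^ 2 + 1 ≠ 0 := by positivity
  rw [div_eq_iff hd]
  field_simp
  linear_combination -hsq

/-- explicit form of `S₁(x;n)` for genus one. -/
theorem S1_explicit
    (α β : ℝ) (hα : (-1:ℝ) < α) (hαβ : α < β) (hβ : β < 1)
    (E : Set ℝ) (hE : E = Set.Icc (-1) α ∪ Set.Icc β 1)
    (w : ℝ → ℝ)
    (hw : ∀ x, w x = (1 / Real.pi) * Real.sqrt ((x - α) / ((1 - x ^ 2) * (x - β))))
    (hw0 : ∀ x ∈ E, 0 ≤ w x)
    (hwint : MeasureTheory.IntegrableOn w E)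
    (P : ℕ → Polynomial ℝ) (h : ℕ → ℝ) (a b : ℕ → ℝ)
    (hPmonic : ∀ n, (P n).Monic)
    (hPdeg : ∀ n, (P n).natDegree = n)
    (hh : ∀ n, 0 < h n)
    (horth : ∀ n m, ∫ x in E, (P n).eval x * (P m).eval x * w x = if n = m then h n else 0)
    (ha : ∀ n, 1 ≤ n → 0 < a n)
    (hrec0 : P 1 = (Polynomial.X - Polynomial.C (b 1)) * P 0)
    (hrec : ∀ n, 1 ≤ n →
      P (n + 1) = (Polynomial.X - Polynomial.C (b (n + 1))) * P n - Polynomial.C (a n) * P (n - 1))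
    (Q : ℕ → Polynomial ℝ)
    (hQ : ∀ n x, (Q n).eval x = ∫ t in E, ((P n).eval x - (P n).eval t) / (x - t) * w t)
    (n : ℕ) (hn : 1 ≤ n) :
    ∀ x : ℝ,
      (P n).eval x ^ 2 * (x - α) - (Q n).eval x ^ 2 * (x ^ 2 - 1) * (x - β) =
        2 * h n * (x + b (n + 1) - (α + β) / 2) := by
  have hEc : IsCompact E := hE ▸ isCompact_Icc.union isCompact_Icc
  have hm := hEc.measurableSet
  have hE1 : E ⊆ Set.Icc (-1) 1 := by
    rw [hE]
    rintro x (hx | hx)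
    · exact ⟨hx.1, by linarith [hx.2]⟩
    · exact ⟨by linarith [hx.1], hx.2⟩
  have hww : w = bandWeight α β := funext hw
  have hint : ∀ q : Polynomial ℝ, IntegrableOn (fun t => q.eval t * w t) E := fun q =>
    hwint.continuousOn_mul q.continuousOn hEc
  have hu : IntegrableOn (fun t => (P n).eval t ^ 2 * w t) E := by
    simpa only [sq, eval_mul] using hint (P n * P n)
  have hnorm : ∫ t in E, (P n).eval t ^ 2 * w t = h n := by
    simpa [sq] using horth n n
  have hfirst : ∫ t in E, t * ((P n).eval t ^ 2 * w t) = b (n + 1) * h n := by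
    have i1 : IntegrableOn (fun t => (P (n + 1)).eval t * (P n).eval t * w t) E := by
      simpa only [eval_mul] using hint (P (n + 1) * P n)
    have i2 : IntegrableOn (fun t => (P (n - 1)).eval t * (P n).eval t * w t) E := by
      simpa only [eval_mul] using hint (P (n - 1) * P n)
    calc ∫ t in E, t * ((P n).eval t ^ 2 * w t)
        = ∫ t in E, (((P (n + 1)).eval t * (P n).eval t * w t +
            b (n + 1) * ((P n).eval t ^ 2 * w t)) +
            a n * ((P (n - 1)).eval t * (P n).eval t * w t)) := by
          congr 1
          ext t
          have := congrArg (eval t) (hrec n hn)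
          simp only [eval_sub, eval_mul, eval_X, eval_C] at this
          rw [this]
          ring
      _ = b (n + 1) * h n := by
          have i12 : IntegrableOn (fun t => (P (n + 1)).eval t * (P n).eval t * w t +
            b (n + 1) * ((P n).eval t ^ 2 * w t)) E := i1.add (hu.const_mul _)
          rw [integral_add i12 (i2.const_mul _), integral_add i1 (hu.const_mul _),
            integral_const_mul, integral_const_mul, hnorm,
            horth, horth, if_neg (by omega), if_neg (by omega)]
          ring
  set G : ℝ → ℝ := fun z => ∫ t in E, 1 / (z - t) * ((P n).eval t ^ 2 * w t) with hG
  set r : ℝ → ℝ := fun z => Real.sqrt ((z ^ 2 - 1) * (z - α) * (z - β)) with hr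
  have hGlim : Tendsto (fun z => z ^ 2 * G z - z * h n) atTop (𝓝 (b (n + 1) * h n)) := by
    simpa only [hnorm, hfirst] using tendsto_cauchy_second_moment hEc hE1 hu
  have hremainder : ∀ z, 1 < z →
      (P n).eval z * ((P n).eval z * ((z - α) / r z) - (Q n).eval z) = G z := by
    intro z hz
    have hmass : ∫ t in E, 1 / (z - t) * w t = (z - α) / r z := by
      rw [hr, ← integral_cauchy_bandWeight hα hαβ hβ (hE ▸ hww ▸ hwint) hz, ← hE, hww]
      simp only [one_div_mul_eq_div]
    have hzt : ∀ t ∈ E, z - t ≠ 0 := fun t ht => by linarith [(hE1 ht).2]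
    set q := P n /ₘ (X - C z) with hq
    have hdiv : ∀ t, (P n).eval t = (P n).eval z + (t - z) * q.eval t := by
      intro t
      have := congrArg (eval t) (modByMonic_add_div (P n) (X - C z))
      rw [modByMonic_X_sub_C_eq_C_eval] at this
      simpa using this.symm
    have hqdeg : q.degree < n := by
      have h1 := degree_divByMonic_lt (P n) (X - C z) (hPmonic n).ne_zero (by simp)
      rwa [degree_eq_natDegree (hPmonic n).ne_zero, hPdeg] at h1
    have hqorth := integral_mul_eq_zero_of_degree_lt hPmonic hPdeg hint
      (fun i j hij => by rw [horth, if_neg hij]) le_rfl hqdeg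
    have hQz : (Q n).eval z = ∫ t in E, q.eval t * w t := by
      rw [hQ]
      refine setIntegral_congr_fun hm fun t ht => ?_
      have := hzt t ht
      rw [hdiv t]
      field_simp
      ring
    have j1 := integrableOn_mul_cauchy hEc hE1 hwint hz (f := fun _ => 1) (by fun_prop)
    have j2 : IntegrableOn (fun t => q.eval t * (P n).eval t * w t) E := by
      simpa only [eval_mul] using hint (q * P n)
    rw [← hmass, hQz, ← integral_const_mul, ← integral_sub (j1.const_mul _) (hint q),
      ← integral_const_mul, ← sub_zero (∫ t in E, _), ← hqorth, ← integral_sub _ j2]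
    · refine setIntegral_congr_fun hm fun t ht => ?_
      have := hzt t ht
      rw [hdiv t]
      field_simp
      ring
    · exact ((j1.const_mul _).sub (hint q)).const_mul _
  set S : Polynomial ℝ := P n ^ 2 * (X - C α) - Q n ^ 2 * (X ^ 2 - 1) * (X - C β) -
    C (2 * h n) * (X + C (b (n + 1)) - C ((α + β) / 2)) with hS
  suffices hS0 : S = 0 by
    intro x
    have := congrArg (eval x) hS0
    simp only [hS, eval_sub, eval_mul, eval_pow, eval_X, eval_C, eval_add, eval_one,
      eval_zero] at this
    linarith
  have hPtop : Tendsto (fun z => (P n).eval z) atTop atTop :=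
    tendsto_atTop_of_leadingCoeff_nonneg _
      (natDegree_pos_iff_degree_pos.1 (by rw [hPdeg]; exact hn))
      (by rw [(hPmonic n).leadingCoeff]; exact zero_le_one)
  have hzP : Tendsto (fun z => z / (P n).eval z ^ 2) atTop (𝓝 0) := by
    have := div_tendsto_atTop_zero_of_degree_lt (X : Polynomial ℝ) (P n ^ 2) (by
      rw [degree_X, degree_pow, degree_eq_natDegree (hPmonic n).ne_zero, hPdeg]
      have : 1 < 2 * n := by omega
      rw [nsmul_eq_mul]
      exact_mod_cast this)
    simpa using this
  have hi := tendsto_inv_atTop_zero (𝕜 := ℝ)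
  have hzG : Tendsto (fun z => z * G z) atTop (𝓝 (h n)) := by
    have := (hGlim.mul hi).add_const (h n)
    rw [mul_zero, zero_add] at this
    refine this.congr' ?_
    filter_upwards [eventually_gt_atTop 0] with z hz
    field_simp
    ring
  have hcubic : Tendsto (fun z : ℝ => (1 - z⁻¹ ^ 2) * (1 - β * z⁻¹)) atTop (𝓝 1) := by
    simpa using ((hi.pow 2).const_sub 1).mul ((hi.const_mul β).const_sub 1)
  have hlim : Tendsto (fun z => S.eval z) atTop (𝓝 0) := by
    have t1 := ((tendsto_sqrt_quartic_div_sq α β).mul hGlim).add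
      ((tendsto_sqrt_quartic_sub α β).const_mul (h n))
    have t2 := (hcubic.mul (hzG.pow 2)).mul hzP
    have t3 := ((t1.sub_const (h n * (b (n + 1) - (α + β) / 2))).const_mul 2).sub t2
    rw [show 2 * (1 * (b (n + 1) * h n) + h n * -((α + β) / 2) -
      h n * (b (n + 1) - (α + β) / 2)) - 1 * h n ^ 2 * 0 = 0 by ring] at t3
    refine t3.congr' ?_
    filter_upwards [eventually_gt_atTop 1, hPtop.eventually_gt_atTop 0] with z hz hPz
    have hW : 0 < (z ^ 2 - 1) * (z - α) * (z - β) :=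
      mul_pos (mul_pos (by nlinarith) (by linarith)) (by linarith)
    have hrpos : 0 < r z := Real.sqrt_pos.2 hW
    have hrsq : r z ^ 2 = (z ^ 2 - 1) * (z - α) * (z - β) := Real.sq_sqrt hW.le
    have hrem := hremainder z hz
    have hQz : (Q n).eval z = (P n).eval z * ((z - α) / r z) - G z / (P n).eval z := by
      rw [← hrem]
      field_simp
      ring
    have hz0 : z ≠ 0 := by linarith
    simp only [hS, eval_sub, eval_mul, eval_pow, eval_X, eval_C, eval_add, eval_one]
    rw [hQz]
    change 2 * (r z / z ^ 2 * (z ^ 2 * G z - z * h n) + h n * (r z / z - z) - _) - _ = _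
    generalize r z = R at *
    generalize G z = g at *
    generalize (P n).eval z = p at *
    have e1 : R / z ^ 2 * (z ^ 2 * g - z * h n) + h n * (R / z - z) = R * g - h n * z := by
      field_simp
      ring
    have e2 : (1 - z⁻¹ ^ 2) * (1 - β * z⁻¹) * (z * g) ^ 2 * (z / p ^ 2) =
        (z ^ 2 - 1) * (z - β) * (g / p) ^ 2 := by
      field_simp
    have e3 : (p * ((z - α) / R) - g / p) ^ 2 * (z ^ 2 - 1) * (z - β) =
        p ^ 2 * (z - α) - 2 * R * g + (z ^ 2 - 1) * (z - β) * (g / p) ^ 2 := by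
      have hV : 0 < (z ^ 2 - 1) * (z - β) := mul_pos (by nlinarith) (by linarith)
      have hA : z - α = R ^ 2 / ((z ^ 2 - 1) * (z - β)) := by
        rw [hrsq, eq_div_iff hV.ne']; ring
      rw [hA, mul_assoc]
      generalize (z ^ 2 - 1) * (z - β) = V at *
      field_simp
      ring
    rw [e1, e2, e3]
    ring
  rw [Polynomial.tendsto_nhds_iff] at hlim
  exact leadingCoeff_eq_zero.1 hlim.1
end

section
/- The recurrence coefficients satisfy, for every n ≥ 3: a_n · ( b_{n+1} + b_n − (α + β)/2 ) = a_{n−1} · ( b_n + b_{n−1} − (α + β)/2 ). -/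
open MeasureTheory Polynomial

theorem quad_ne_zero {γ : ℝ} (hγ : |γ| < 1) {ζ : ℂ} (hζ : ‖ζ‖ < 1) :
    ζ ^ 2 - 2 * γ * ζ + 1 ≠ 0 := by
  intro h
  have hre := congrArg Complex.re h
  have him := congrArg Complex.im h
  simp [pow_two] at hre him
  have hn : ζ.re * ζ.re + ζ.im * ζ.im < 1 := by
    rw [← Complex.normSq_apply, Complex.normSq_eq_norm_sq]
    have := norm_nonneg ζ
    nlinarith
  have hγ2 : γ ^ 2 < 1 := (sq_lt_one_iff_abs_lt_one γ).2 hγ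
  have h0 : ζ.im * (ζ.re - γ) = 0 := by linarith
  rcases mul_eq_zero.1 h0 with h0 | h0
  · rw [h0] at hre
    nlinarith [sq_nonneg (ζ.re - γ)]
  · have : ζ.re = γ := by linarith
    rw [this] at hre hn
    nlinarith

theorem quad_ratio_mem_slitPlane {α β : ℝ} (hα : |α| < 1) (hβ : |β| < 1) {ζ : ℂ}
    (hζ : ‖ζ‖ < 1) :
    (ζ ^ 2 - 2 * α * ζ + 1) / (ζ ^ 2 - 2 * β * ζ + 1) ∈ Complex.slitPlane := by
  rw [Complex.mem_slitPlane_iff_not_le_zero]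
  intro hle
  obtain ⟨h1, h2⟩ := Complex.le_def.1 hle
  set q := (ζ ^ 2 - 2 * α * ζ + 1) / (ζ ^ 2 - 2 * β * ζ + 1) with hq
  have hqt : q = ((q.re : ℝ) : ℂ) := Complex.ext (by simp) (by simpa using h2)
  set t := q.re
  have ht : t ≤ 0 := by simpa using h1
  rw [hqt, eq_div_iff (quad_ne_zero hβ hζ)] at hq
  have h1t : (1 - t : ℝ) ≠ 0 := by linarith
  have h1t' : (1 - t : ℂ) ≠ 0 := by exact_mod_cast h1t
  have habs : |(α - t * β) / (1 - t)| < 1 := by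
    rw [abs_lt] at *
    constructor
    · rw [lt_div_iff₀ (by linarith)]; nlinarith
    · rw [div_lt_iff₀ (by linarith)]; nlinarith
  apply quad_ne_zero habs hζ
  push_cast
  field_simp
  linear_combination -hq

theorem le_norm_quad (β : ℝ) (hβ : |β| < 1) {r : ℝ} (hr : 0 < r) (θ : ℝ) :
    2 * r * |Real.cos θ - β| ≤
      ‖circleMap 0 r θ ^ 2 - 2 * β * circleMap 0 r θ + 1‖ := by
  have hc := Real.sin_sq_add_cos_sq θ
  have h1 : circleMap 0 r θ ^ 2 - 2 * β * circleMap 0 r θ + 1 =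
      ((r ^ 2 * (Real.cos θ ^ 2 - Real.sin θ ^ 2) - 2 * β * r * Real.cos θ + 1 : ℝ) : ℂ) +
      ((2 * r ^ 2 * Real.cos θ * Real.sin θ - 2 * β * r * Real.sin θ : ℝ) : ℂ) * Complex.I := by
    simp only [circleMap, Complex.exp_mul_I, zero_add]
    push_cast
    linear_combination ((r : ℂ) ^ 2 * Complex.sin θ ^ 2) * Complex.I_sq
  rw [h1]
  refine (pow_le_pow_iff_left₀ (by positivity) (norm_nonneg _) two_ne_zero).1 ?_
  rw [← Complex.normSq_eq_norm_sq, Complex.normSq_add_mul_I, mul_pow, sq_abs]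
  set c := Real.cos θ
  set s := Real.sin θ
  have hs : s ^ 2 = 1 - c ^ 2 := by linarith
  have hcb : c * β ≤ 1 := by
    exact (le_abs_self _).trans ((abs_mul c β).le.trans (mul_le_one₀ (Real.abs_cos_le_one θ)
      (abs_nonneg β) hβ.le))
  have key : (r ^ 2 * (c ^ 2 - s ^ 2) - 2 * β * r * c + 1) ^ 2
      + (2 * r ^ 2 * c * s - 2 * β * r * s) ^ 2 - (2 * r) ^ 2 * (c - β) ^ 2
      = (1 - r) ^ 2 * ((1 + r) ^ 2 - 4 * r * (c * β)) := by
    rw [show (2 * r ^ 2 * c * s - 2 * β * r * s) ^ 2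
      = (2 * r ^ 2 * c - 2 * β * r) ^ 2 * s ^ 2 by ring, hs]
    ring
  have : 0 ≤ (1 - r) ^ 2 * ((1 + r) ^ 2 - 4 * r * (c * β)) := by
    apply mul_nonneg (sq_nonneg _)
    nlinarith [sq_nonneg (1 - r)]
  linarith

/-- The real part of the principal square root. -/
noncomputable def reSqrt (z : ℂ) : ℝ := √((‖z‖ + z.re) / 2)

theorem continuous_reSqrt : Continuous reSqrt := by
  unfold reSqrt; fun_prop

theorem reSqrt_ofReal (t : ℝ) : reSqrt t = √t := by
  rw [reSqrt]
  rcases le_total 0 t with h | h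
  · simp [abs_of_nonneg h]
  · simp [abs_of_nonpos h, Real.sqrt_eq_zero_of_nonpos h]

theorem abs_reSqrt_le (z : ℂ) : |reSqrt z| ≤ √‖z‖ := by
  rw [reSqrt, abs_of_nonneg (Real.sqrt_nonneg _)]
  apply Real.sqrt_le_sqrt
  have := Complex.re_le_norm z
  linarith

/-- With `x = (ζ + ζ⁻¹) / 2` this is `(x - α) / (x - β)`. -/
noncomputable def quadRatio (α β : ℝ) (ζ : ℂ) : ℂ :=
  (ζ ^ 2 - 2 * α * ζ + 1) / (ζ ^ 2 - 2 * β * ζ + 1)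

/-- The Poisson formula for `Re √(quadRatio α β (r ζ))` at the point `η`. -/
theorem poisson_reSqrt {α β : ℝ} (hα : |α| < 1) (hβ : |β| < 1) {r η : ℝ} (hr : 0 < r)
    (hr1 : r < 1) (hη : 0 < η) (hη1 : η < 1) :
    ∫ θ in 0..(2 * Real.pi), (1 - η ^ 2) / (1 - 2 * η * Real.cos θ + η ^ 2) *
      reSqrt (quadRatio α β (circleMap 0 r θ)) =
    2 * Real.pi * reSqrt (quadRatio α β ((r * η : ℝ) : ℂ)) := by
  set f : ℂ → ℂ := fun ζ => (quadRatio α β (r * ζ)) ^ (2⁻¹ : ℂ) with hf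
  have hfd : DifferentiableOn ℂ f (Metric.closedBall 0 1) := by
    intro ζ hζ
    have hζ' : ‖(r : ℂ) * ζ‖ < 1 := by
      rw [norm_mul, Complex.norm_real, Real.norm_of_nonneg hr.le]
      have : ‖ζ‖ ≤ 1 := by simpa using hζ
      nlinarith [norm_nonneg ζ]
    apply DifferentiableAt.differentiableWithinAt
    apply DifferentiableAt.cpow _ (by fun_prop)
    · exact quad_ratio_mem_slitPlane hα hβ hζ'
    · unfold quadRatio
      apply DifferentiableAt.div (by fun_prop) (by fun_prop)
      exact quad_ne_zero hβ hζ'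
  have hd : DiffContOnCl ℂ f (Metric.ball 0 1) := by
    apply DifferentiableOn.diffContOnCl
    rwa [closure_ball _ one_ne_zero]
  have hηb : (η : ℂ) ∈ Metric.ball (0 : ℂ) 1 := by
    simp [abs_of_pos hη, hη1]
  have hp := hd.circleAverage_poissonKernel_smul hηb
  have hcont : CircleIntegrable (poissonKernel 0 (η : ℂ) • f) 0 1 := by
    apply ContinuousOn.circleIntegrable zero_le_one
    apply ContinuousOn.smul
    · unfold poissonKernel
      apply ContinuousOn.div (by fun_prop) (by fun_prop)
      intro x hx h0
      have : x = η := by simpa [sub_eq_zero] using h0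
      rw [this] at hx
      have : |η| = 1 := by simpa using hx
      rw [abs_of_pos hη] at this
      linarith
    · exact hfd.continuousOn.mono Metric.sphere_subset_closedBall
  have hp2 := Complex.reCLM.circleAverage_comp_comm hcont
  rw [hp, Real.circleAverage_def] at hp2
  have h3 : Complex.reCLM (f η) = reSqrt (quadRatio α β ((r * η : ℝ) : ℂ)) := by
    simp [hf, Complex.cpow_inv_two_re, reSqrt]
  rw [h3, smul_eq_mul] at hp2
  rw [← hp2, mul_inv_cancel_left₀ (by positivity)]
  apply intervalIntegral.integral_congr
  intro θ _
  have h4 : circleMap 0 r θ = r * circleMap 0 1 θ := by simp [circleMap]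
  have h5 : poissonKernel 0 (η : ℂ) (circleMap 0 1 θ) =
      (1 - η ^ 2) / (1 - 2 * η * Real.cos θ + η ^ 2) := by
    rw [poissonKernel]
    congr 1
    · simp
    · have hc := Real.sin_sq_add_cos_sq θ
      rw [← Complex.normSq_eq_norm_sq]
      simp only [circleMap, Complex.exp_mul_I, Complex.normSq_apply]
      simp [← Complex.ofReal_cos, ← Complex.ofReal_sin]
      nlinarith
  simp only [Function.comp, Pi.smul_apply', h5, Complex.reCLM_apply, Complex.real_smul,
    Complex.re_ofReal_mul, hf, Complex.cpow_inv_two_re, h4, reSqrt]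

theorem reSqrt_conj (z : ℂ) : reSqrt (starRingEnd ℂ z) = reSqrt z := by
  simp [reSqrt]

theorem reSqrt_quadRatio_circleMap_neg (α β r θ : ℝ) :
    reSqrt (quadRatio α β (circleMap 0 r (2 * Real.pi - θ))) =
      reSqrt (quadRatio α β (circleMap 0 r θ)) := by
  rw [← reSqrt_conj (quadRatio α β (circleMap 0 r θ))]
  have : circleMap 0 r (2 * Real.pi - θ) = starRingEnd ℂ (circleMap 0 r θ) := by
    have h : circleMap 0 r (2 * Real.pi - θ) = circleMap 0 r (-θ) := by
      rw [← periodic_circleMap 0 r (-θ)]; ring_nf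
    rw [h]
    simp [circleMap, ← Complex.exp_conj]
  rw [this]
  simp [quadRatio, Complex.conj_ofNat]

theorem continuous_reSqrt_circle {α β : ℝ} (hβ : |β| < 1) {r : ℝ} (hr : 0 < r)
    (hr1 : r < 1) : Continuous fun θ => reSqrt (quadRatio α β (circleMap 0 r θ)) := by
  apply continuous_reSqrt.comp
  unfold quadRatio
  apply Continuous.div (by fun_prop) (by fun_prop)
  intro θ
  exact quad_ne_zero hβ (by simpa [abs_of_pos hr] using hr1)

theorem kernel_denom_pos {η : ℝ} (hη : 0 < η) (hη1 : η < 1) (θ : ℝ) :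
    0 < 1 - 2 * η * Real.cos θ + η ^ 2 := by
  nlinarith [Real.cos_le_one θ, sq_nonneg (1 - η), mul_pos (sub_pos.2 hη1) (sub_pos.2 hη1)]

theorem poisson_reSqrt_half {α β : ℝ} (hα : |α| < 1) (hβ : |β| < 1) {r η : ℝ} (hr : 0 < r)
    (hr1 : r < 1) (hη : 0 < η) (hη1 : η < 1) :
    ∫ θ in 0..Real.pi, (1 - η ^ 2) / (1 - 2 * η * Real.cos θ + η ^ 2) *
      reSqrt (quadRatio α β (circleMap 0 r θ)) =
    Real.pi * reSqrt (quadRatio α β ((r * η : ℝ) : ℂ)) := by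
  have h := poisson_reSqrt hα hβ hr hr1 hη hη1
  set g : ℝ → ℝ := fun θ => (1 - η ^ 2) / (1 - 2 * η * Real.cos θ + η ^ 2) *
      reSqrt (quadRatio α β (circleMap 0 r θ)) with hg
  have hgc : Continuous g := by
    apply Continuous.mul _ (continuous_reSqrt_circle hβ hr hr1)
    apply Continuous.div (by fun_prop) (by fun_prop)
    exact fun θ => (kernel_denom_pos hη hη1 θ).ne'
  have hs : ∀ θ, g (2 * Real.pi - θ) = g θ := by
    intro θ
    simp only [hg, reSqrt_quadRatio_circleMap_neg, Real.cos_two_pi_sub]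
  have h2 : ∫ θ in Real.pi..(2 * Real.pi), g θ = ∫ θ in 0..Real.pi, g θ := by
    have := intervalIntegral.integral_comp_sub_left (a := 0) (b := Real.pi) g (2 * Real.pi)
    simp only [hs] at this
    rw [this]
    congr 1 <;> ring
  rw [← intervalIntegral.integral_add_adjacent_intervals (hgc.intervalIntegrable 0 Real.pi)
    (hgc.intervalIntegrable Real.pi (2 * Real.pi)), h2] at h
  linarith

theorem exists_mul_abs_sub_le_abs_cos_sub_cos {ψ : ℝ} (hψ : 0 < ψ) (hψ' : ψ < Real.pi) :
    ∃ m > 0, ∀ θ ∈ Set.Icc 0 Real.pi, m * |θ - ψ| ≤ |Real.cos θ - Real.cos ψ| := by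
  have hpi := Real.pi_pos
  have h1 : 0 < Real.sin (ψ / 2) := Real.sin_pos_of_pos_of_lt_pi (by linarith) (by linarith)
  have h2 : 0 < Real.sin ((Real.pi + ψ) / 2) :=
    Real.sin_pos_of_pos_of_lt_pi (by linarith) (by linarith)
  refine ⟨2 / Real.pi * min (Real.sin (ψ / 2)) (Real.sin ((Real.pi + ψ) / 2)),
    mul_pos (by positivity) (lt_min h1 h2), fun θ hθ => ?_⟩
  have h3 : min (Real.sin (ψ / 2)) (Real.sin ((Real.pi + ψ) / 2)) ≤ Real.sin ((θ + ψ) / 2) := by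
    apply strictConcaveOn_sin_Icc.concaveOn.min_le_of_mem_Icc
    · constructor <;> linarith
    · constructor <;> linarith
    · constructor <;> linarith [hθ.1, hθ.2]
  have h4 : 2 / Real.pi * |(θ - ψ) / 2| ≤ |Real.sin ((θ - ψ) / 2)| := by
    apply Real.mul_abs_le_abs_sin
    rw [abs_le]
    constructor <;> linarith [hθ.1, hθ.2]
  rw [Real.cos_sub_cos, abs_mul, abs_mul, abs_neg, abs_two]
  have h5 : 0 ≤ 2 / Real.pi * |(θ - ψ) / 2| := by positivity
  have h6 := mul_le_mul (h3.trans (le_abs_self _)) h4 h5 (abs_nonneg _)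
  have h7 : |(θ - ψ) / 2| = |θ - ψ| / 2 := by rw [abs_div, abs_two]
  rw [h7] at h6
  nlinarith

theorem intervalIntegrable_inv_sqrt_abs_sub {a b : ℝ} {ψ : ℝ}
    (hψ : ψ ∈ Set.Icc a b) :
    IntervalIntegrable (fun θ => (√|θ - ψ|)⁻¹) volume a b := by
  have key : ∀ c : ℝ, IntervalIntegrable (fun x : ℝ => x ^ (-(1 / 2) : ℝ)) volume 0 c :=
    fun c => intervalIntegral.intervalIntegrable_rpow' (by norm_num)
  have e : ∀ x : ℝ, 0 ≤ x → x ^ (-(1 / 2) : ℝ) = (√|x|)⁻¹ := by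
    intro x hx
    rw [Real.rpow_neg hx, Real.sqrt_eq_rpow, abs_of_nonneg hx]
  have h1 := (key (ψ - a)).comp_sub_left ψ
  have h2 := (key (b - ψ)).comp_sub_right ψ
  simp only [sub_zero, sub_sub_cancel, zero_add, sub_add_cancel] at h1 h2
  refine IntervalIntegrable.trans (b := ψ) (h1.symm.congr ?_) (h2.congr ?_)
  · intro θ hθ
    rw [Set.uIoc_of_le hψ.1] at hθ
    simp only
    rw [e _ (by linarith [hθ.2]), abs_sub_comm]
  · intro θ hθ
    rw [Set.uIoc_of_le hψ.2] at hθ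
    exact e _ (by linarith [hθ.1])

theorem intervalIntegrable_inv_sqrt_abs_cos_sub {β : ℝ} (hβ : |β| < 1) :
    IntervalIntegrable (fun θ => (√|Real.cos θ - β|)⁻¹) volume 0 Real.pi := by
  obtain ⟨h1, h2⟩ := abs_lt.1 hβ
  have hψ : 0 < Real.arccos β := Real.arccos_pos.2 h2
  have hψ' : Real.arccos β < Real.pi := by
    rw [Real.arccos_lt_pi]; exact h1
  obtain ⟨m, hm, hle⟩ := exists_mul_abs_sub_le_abs_cos_sub_cos hψ hψ'
  rw [Real.cos_arccos h1.le h2.le] at hle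
  have h := (intervalIntegrable_inv_sqrt_abs_sub ⟨hψ.le, hψ'.le⟩).const_mul (√m)⁻¹
  refine h.mono_fun' (by fun_prop) ?_
  have hne : ∀ᵐ θ ∂(volume.restrict (Set.uIoc 0 Real.pi)), θ ≠ Real.arccos β :=
    ae_restrict_of_ae (Measure.ae_ne volume _)
  filter_upwards [hne, ae_restrict_mem measurableSet_uIoc] with θ hθ hθ2
  rw [Set.uIoc_of_le Real.pi_pos.le] at hθ2
  have h3 : 0 < |θ - Real.arccos β| := abs_pos.2 (sub_ne_zero.2 hθ)
  rw [Real.norm_of_nonneg (by positivity), ← mul_inv, ← Real.sqrt_mul hm.le]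
  apply inv_anti₀ (by positivity)
  exact Real.sqrt_le_sqrt (hle θ ⟨hθ2.1.le, hθ2.2⟩)

theorem quadRatio_circleMap_one {α β θ : ℝ} :
    quadRatio α β (circleMap 0 1 θ) = (((Real.cos θ - α) / (Real.cos θ - β) : ℝ) : ℂ) := by
  have h : ∀ γ : ℝ, circleMap 0 1 θ ^ 2 - 2 * γ * circleMap 0 1 θ + 1 =
      2 * circleMap 0 1 θ * ((Real.cos θ - γ : ℝ) : ℂ) := by
    intro γ
    simp only [circleMap, Complex.exp_mul_I, zero_add]
    push_cast
    linear_combination (Complex.sin θ ^ 2) * Complex.I_sq - Complex.sin_sq_add_cos_sq θ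
  rw [quadRatio, h, h, mul_div_mul_left]
  · push_cast; rfl
  · simp

theorem norm_quad_le {α : ℝ} (hα : |α| < 1) {ζ : ℂ} (hζ : ‖ζ‖ ≤ 1) :
    ‖ζ ^ 2 - 2 * α * ζ + 1‖ ≤ 4 := by
  have h1 : ‖ζ ^ 2‖ ≤ 1 := by rw [norm_pow]; exact pow_le_one₀ (norm_nonneg _) hζ
  have h2 : ‖2 * (α : ℂ) * ζ‖ ≤ 2 := by
    rw [norm_mul, norm_mul, Complex.norm_real, Real.norm_eq_abs, RCLike.norm_two]
    nlinarith [norm_nonneg ζ, abs_nonneg α]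
  calc _ ≤ ‖ζ ^ 2 - 2 * α * ζ‖ + ‖(1 : ℂ)‖ := norm_add_le _ _
    _ ≤ ‖ζ ^ 2‖ + ‖2 * (α : ℂ) * ζ‖ + ‖(1 : ℂ)‖ := by gcongr; exact norm_sub_le _ _
    _ ≤ 4 := by rw [norm_one]; linarith

theorem abs_reSqrt_quadRatio_le {α β : ℝ} (hα : |α| < 1) (hβ : |β| < 1) {r : ℝ}
    (hr : 1 / 2 ≤ r) (hr1 : r ≤ 1) {θ : ℝ} (hθ : Real.cos θ ≠ β) :
    |reSqrt (quadRatio α β (circleMap 0 r θ))| ≤ 2 * (√|Real.cos θ - β|)⁻¹ := by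
  have hpos : 0 < |Real.cos θ - β| := abs_pos.2 (sub_ne_zero.2 hθ)
  refine (abs_reSqrt_le _).trans ?_
  have h4 : (2 : ℝ) = √4 := by
    rw [show (4 : ℝ) = 2 ^ 2 by norm_num, Real.sqrt_sq (by norm_num)]
  rw [h4, ← Real.sqrt_inv, ← Real.sqrt_mul (by norm_num), ← div_eq_mul_inv]
  apply Real.sqrt_le_sqrt
  rw [quadRatio, norm_div]
  have hle := le_norm_quad β hβ (by linarith : 0 < r) θ
  apply div_le_div₀ (by norm_num) (norm_quad_le hα _) hpos (le_trans _ hle)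
  · simp only [norm_circleMap_zero]
    rw [abs_of_nonneg (by linarith)]; exact hr1
  · nlinarith

/-- The limit `r → 1` of the Poisson formula. -/
theorem poisson_boundary {α β : ℝ} (hα : |α| < 1) (hβ : |β| < 1) {η : ℝ}
    (hη : 0 < η) (hη1 : η < 1) :
    ∫ θ in 0..Real.pi, (1 - η ^ 2) / (1 - 2 * η * Real.cos θ + η ^ 2) *
      √((Real.cos θ - α) / (Real.cos θ - β)) =
    Real.pi * √((η ^ 2 - 2 * α * η + 1) / (η ^ 2 - 2 * β * η + 1)) := by
  have hne : ∀ᵐ θ : ℝ ∂volume, θ ∈ Set.uIoc 0 Real.pi → Real.cos θ ≠ β := by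
    filter_upwards [Measure.ae_ne volume (Real.arccos β)] with θ hθ hmem h
    rw [Set.uIoc_of_le Real.pi_pos.le] at hmem
    apply hθ
    rw [← h, Real.arccos_cos hmem.1.le hmem.2]
  have hev : ∀ᶠ r : ℝ in nhdsWithin 1 (Set.Iio 1), 1 / 2 ≤ r ∧ r < 1 := by
    filter_upwards [Ico_mem_nhdsLT (by norm_num : (1 / 2 : ℝ) < 1)] with r hr using hr
  have hlim1 : Filter.Tendsto (fun r : ℝ => ∫ θ in 0..Real.pi,
      (1 - η ^ 2) / (1 - 2 * η * Real.cos θ + η ^ 2) *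
      reSqrt (quadRatio α β (circleMap 0 r θ))) (nhdsWithin 1 (Set.Iio 1))
      (nhds (∫ θ in 0..Real.pi, (1 - η ^ 2) / (1 - 2 * η * Real.cos θ + η ^ 2) *
      √((Real.cos θ - α) / (Real.cos θ - β)))) := by
    apply intervalIntegral.tendsto_integral_filter_of_dominated_convergence
      (fun θ => (1 - η ^ 2) / (1 - η) ^ 2 * (2 * (√|Real.cos θ - β|)⁻¹))
    · filter_upwards [hev] with r hr
      apply Continuous.aestronglyMeasurable
      apply Continuous.mul _ (continuous_reSqrt_circle hβ (by linarith) hr.2)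
      apply Continuous.div (by fun_prop) (by fun_prop)
      exact fun θ => (kernel_denom_pos hη hη1 θ).ne'
    · filter_upwards [hev] with r hr
      filter_upwards [hne] with θ hθ hmem
      rw [norm_mul]
      apply mul_le_mul _ (abs_reSqrt_quadRatio_le hα hβ hr.1 hr.2.le (hθ hmem)) (abs_nonneg _)
      · apply div_nonneg _ (sq_nonneg _); nlinarith
      · have hk := kernel_denom_pos hη hη1 θ
        rw [Real.norm_of_nonneg (div_nonneg (by nlinarith) hk.le)]
        have : 0 < 1 - η := by linarith
        apply div_le_div_of_nonneg_left (by nlinarith) (by positivity)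
        nlinarith [Real.cos_le_one θ]
    · exact ((intervalIntegrable_inv_sqrt_abs_cos_sub hβ).const_mul 2).const_mul _
    · filter_upwards [hne] with θ hθ hmem
      apply Filter.Tendsto.const_mul
      rw [← reSqrt_ofReal, ← quadRatio_circleMap_one]
      have hc : ContinuousAt (fun r : ℝ => reSqrt (quadRatio α β (circleMap 0 r θ))) 1 := by
        apply continuous_reSqrt.continuousAt.comp
        unfold quadRatio
        apply ContinuousAt.div
        · unfold circleMap; fun_prop
        · unfold circleMap; fun_prop
        · intro h0
          have := le_norm_quad β hβ one_pos θ
          rw [h0, norm_zero] at this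
          have h1 : 0 < |Real.cos θ - β| := abs_pos.2 (sub_ne_zero.2 (hθ hmem))
          linarith
      exact hc.tendsto.mono_left nhdsWithin_le_nhds
  have hlim2 : Filter.Tendsto (fun r : ℝ => Real.pi * reSqrt (quadRatio α β ((r * η : ℝ) : ℂ)))
      (nhdsWithin 1 (Set.Iio 1))
      (nhds (Real.pi * √((η ^ 2 - 2 * α * η + 1) / (η ^ 2 - 2 * β * η + 1)))) := by
    apply Filter.Tendsto.const_mul
    have hc : ContinuousAt (fun r : ℝ => reSqrt (quadRatio α β ((r * η : ℝ) : ℂ))) 1 := by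
      apply continuous_reSqrt.continuousAt.comp
      unfold quadRatio
      apply ContinuousAt.div (by fun_prop) (by fun_prop)
      apply quad_ne_zero hβ
      simp [abs_of_pos hη, hη1]
    have h1 : reSqrt (quadRatio α β ((1 * η : ℝ) : ℂ)) =
        √((η ^ 2 - 2 * α * η + 1) / (η ^ 2 - 2 * β * η + 1)) := by
      rw [← reSqrt_ofReal, quadRatio]
      push_cast
      simp
    rw [← h1]
    exact hc.tendsto.mono_left nhdsWithin_le_nhds
  refine tendsto_nhds_unique hlim1 (hlim2.congr' ?_)
  filter_upwards [hev] with r hr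
  exact (poisson_reSqrt_half hα hβ (by linarith) hr.2 hη hη1).symm

/-- The Stieltjes transform of the weight. -/
theorem setIntegral_weight_div {α β : ℝ} (hα : -1 < α) (hαβ : α < β) (hβ : β < 1) {z : ℝ}
    (hz : 1 < z) :
    ∫ x in Set.Icc (-1) α ∪ Set.Icc β 1,
      1 / Real.pi * √((x - α) / ((1 - x ^ 2) * (x - β))) / (z - x) =
    √((z - α) / ((z ^ 2 - 1) * (z - β))) := by
  have hpi := Real.pi_pos
  set s := √(z ^ 2 - 1) with hs
  have hs2 : s ^ 2 = z ^ 2 - 1 := Real.sq_sqrt (by nlinarith)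
  have hs0 : 0 < s := Real.sqrt_pos.2 (by nlinarith)
  have hsz : s < z := by nlinarith
  have hη : 0 < z - s := by linarith
  have hη1 : z - s < 1 := by nlinarith
  set η := z - s with hη_def
  have hzη : η ^ 2 + 1 = 2 * η * z := by rw [hη_def]; nlinarith
  have hsη : 1 - η ^ 2 = 2 * η * s := by rw [hη_def]; nlinarith
  have hb := poisson_boundary (α := α) (β := β) (abs_lt.2 ⟨hα, by linarith⟩)
    (abs_lt.2 ⟨by linarith, hβ⟩) hη hη1
  have hr : √((η ^ 2 - 2 * α * η + 1) / (η ^ 2 - 2 * β * η + 1)) = √((z - α) / (z - β)) := by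
    congr 1
    rw [show η ^ 2 - 2 * α * η + 1 = 2 * η * (z - α) by linarith,
      show η ^ 2 - 2 * β * η + 1 = 2 * η * (z - β) by linarith, mul_div_mul_left]
    positivity
  have hk : ∀ x : ℝ, (1 - η ^ 2) / (1 - 2 * η * x + η ^ 2) = s / (z - x) := by
    intro x
    rw [hsη, show 1 - 2 * η * x + η ^ 2 = 2 * η * (z - x) by linarith, mul_div_mul_left]
    positivity
  simp only [hk, hr] at hb
  rw [← Polynomial.Chebyshev.integral_measureT_eq_integral_cos
    (f := fun x => s / (z - x) * √((x - α) / (x - β))), Polynomial.Chebyshev.integral_measureT,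
    intervalIntegral.integral_of_le (by norm_num), ← integral_Icc_eq_integral_Ioc] at hb
  have hsub : Set.Icc (-1) α ∪ Set.Icc β 1 ⊆ Set.Icc (-1 : ℝ) 1 := by
    rintro x (hx | hx)
    · exact ⟨hx.1, by linarith [hx.2]⟩
    · exact ⟨by linarith [hx.1], hx.2⟩
  have hzero : ∀ x ∈ Set.Icc (-1 : ℝ) 1 \ (Set.Icc (-1) α ∪ Set.Icc β 1),
      1 / Real.pi * √((x - α) / ((1 - x ^ 2) * (x - β))) / (z - x) = 0 := by
    rintro x ⟨hx, hx'⟩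
    simp only [Set.mem_union, Set.mem_Icc, not_or, not_and, not_le] at hx'
    have h1 := hx'.1 hx.1
    have h2 : x < β := by
      by_contra h
      have := hx'.2 (not_lt.1 h)
      linarith [hx.2]
    rw [Real.sqrt_eq_zero_of_nonpos, mul_zero, zero_div]
    apply div_nonpos_of_nonneg_of_nonpos (by linarith)
    apply mul_nonpos_of_nonneg_of_nonpos <;> nlinarith [hx.1, hx.2]
  rw [← setIntegral_eq_of_subset_of_forall_sdiff_eq_zero measurableSet_Icc hsub hzero]
  have heq : ∀ x ∈ Set.Icc (-1 : ℝ) 1,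
      s / (z - x) * √((x - α) / (x - β)) * √(1 - x ^ 2)⁻¹ =
      (Real.pi * s) * (1 / Real.pi * √((x - α) / ((1 - x ^ 2) * (x - β))) / (z - x)) := by
    intro x hx
    have h0 : 0 ≤ (1 - x ^ 2)⁻¹ := inv_nonneg.2 (by nlinarith [hx.1, hx.2])
    rw [show (x - α) / ((1 - x ^ 2) * (x - β)) = (1 - x ^ 2)⁻¹ * ((x - α) / (x - β)) by
      rw [div_eq_mul_inv, div_eq_mul_inv, mul_inv]; ring, Real.sqrt_mul h0]
    have : z - x ≠ 0 := by linarith [hx.2]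
    field_simp
  rw [setIntegral_congr_fun measurableSet_Icc heq, integral_const_mul] at hb
  have hfin : √((z - α) / ((z ^ 2 - 1) * (z - β))) = √((z - α) / (z - β)) / s := by
    rw [hs, ← Real.sqrt_div' _ (by nlinarith)]
    congr 1
    rw [div_div, mul_comm]
  rw [hfin, eq_div_iff hs0.ne']
  apply mul_left_cancel₀ hpi.ne'
  linarith

section OrthogonalPolynomials

variable {E : Set ℝ} {w : ℝ → ℝ} {P : ℕ → ℝ[X]} {a b : ℕ → ℝ}

theorem integral_orthogonal_mul_pow_eq_zero (hE : IsCompact E) (hw : IntegrableOn w E)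
    (horth : ∀ n, 1 ≤ n → ∫ x in E, (P n).eval x * w x = 0)
    (hrec : ∀ n, 1 ≤ n →
      P (n + 1) = (X - C (b (n + 1))) * P n - C (a n) * P (n - 1))
    (j : ℕ) : ∀ n, j < n → ∫ x in E, (P n).eval x * x ^ j * w x = 0 := by
  induction j with
  | zero => intro n hn; simpa using horth n hn
  | succ j ih =>
    intro n hn
    have hi : ∀ m, IntegrableOn (fun x => (P m).eval x * x ^ j * w x) E := fun m =>
      hw.continuousOn_mul (by fun_prop) hE
    have h : ∀ x, (P n).eval x * x ^ (j + 1) * w x =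
        (P (n + 1)).eval x * x ^ j * w x + b (n + 1) * ((P n).eval x * x ^ j * w x)
        + a n * ((P (n - 1)).eval x * x ^ j * w x) := by
      intro x
      rw [hrec n (by omega)]
      simp only [eval_sub, eval_mul, eval_X, eval_C]
      ring
    simp only [h]
    rw [integral_add (by exact (hi _).add ((hi _).const_mul _)) (by exact (hi _).const_mul _),
      integral_add (hi _) (by exact (hi _).const_mul _), integral_const_mul, integral_const_mul,
      ih (n + 1) (by omega), ih n (by omega), ih (n - 1) (by omega)]
    simp

theorem integrableOn_eval_div_mul (hE : IsCompact E) (hE1 : ∀ x ∈ E, x ≤ 1)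
    (hw : IntegrableOn w E) {g : ℝ → ℝ} (hg : Continuous g) {z : ℝ} (hz : 1 < z) :
    IntegrableOn (fun x => g x / (z - x) * w x) E := by
  refine hw.continuousOn_mul (hg.continuousOn.div (by fun_prop) fun x hx => ?_) hE
  have := hE1 x hx
  linarith

/-- Multiplication by `z` inside a Cauchy transform. -/
theorem mul_integral_div_sub (hE : IsCompact E) (hE1 : ∀ x ∈ E, x ≤ 1)
    (hw : IntegrableOn w E) {g : ℝ → ℝ} (hg : Continuous g) {z : ℝ} (hz : 1 < z) :
    z * ∫ x in E, g x / (z - x) * w x =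
      (∫ x in E, g x * w x) + ∫ x in E, g x * x / (z - x) * w x := by
  rw [← integral_add (hw.continuousOn_mul hg.continuousOn hE)
    (integrableOn_eval_div_mul hE hE1 hw (by fun_prop) hz), ← integral_const_mul]
  refine setIntegral_congr_fun hE.measurableSet fun x hx => ?_
  have : z - x ≠ 0 := by have := hE1 x hx; linarith
  field_simp
  ring

/-- The Cauchy transform `z ↦ ∫ x in E, p x * w x / (z - x)` of `p w`. -/
noncomputable def cauchyTransform (E : Set ℝ) (w : ℝ → ℝ) (p : ℝ[X]) (z : ℝ) : ℝ :=
  ∫ x in E, p.eval x / (z - x) * w x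

theorem cauchyTransform_linear (hE : IsCompact E) (hE1 : ∀ x ∈ E, x ≤ 1)
    (hw : IntegrableOn w E) (p q : ℝ[X]) (β α : ℝ) {z : ℝ} (hz : 1 < z) :
    cauchyTransform E w ((X - C β) * p - C α * q) z =
      (z - β) * cauchyTransform E w p z - α * cauchyTransform E w q z
        - ∫ x in E, p.eval x * w x := by
  have hi : ∀ p : ℝ[X], IntegrableOn (fun x => p.eval x / (z - x) * w x) E :=
    fun p => integrableOn_eval_div_mul hE hE1 hw (by fun_prop) hz
  have hi2 : IntegrableOn (fun x => p.eval x * x / (z - x) * w x) E :=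
    integrableOn_eval_div_mul hE hE1 hw (by fun_prop) hz
  have h := mul_integral_div_sub hE hE1 hw (g := fun x => p.eval x) (by fun_prop) hz
  have h2 : cauchyTransform E w ((X - C β) * p - C α * q) z =
      (∫ x in E, p.eval x * x / (z - x) * w x) - β * cauchyTransform E w p z
      - α * cauchyTransform E w q z := by
    unfold cauchyTransform
    rw [← integral_const_mul, ← integral_const_mul,
      ← integral_sub hi2 (by exact (hi p).const_mul _),
      ← integral_sub (by exact hi2.sub ((hi p).const_mul _)) (by exact (hi q).const_mul _)]
    congr 1
    ext x
    simp only [eval_sub, eval_mul, eval_X, eval_C]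
    ring
  rw [h2]
  unfold cauchyTransform at *
  linarith

theorem pow_mul_cauchyTransform (hE : IsCompact E) (hE1 : ∀ x ∈ E, x ≤ 1)
    (hw : IntegrableOn w E) {p : ℝ[X]} {n : ℕ}
    (hp : ∀ j < n, ∫ x in E, p.eval x * x ^ j * w x = 0) {z : ℝ} (hz : 1 < z) :
    z ^ n * cauchyTransform E w p z = ∫ x in E, p.eval x * x ^ n / (z - x) * w x := by
  induction n with
  | zero => simp [cauchyTransform]
  | succ n ih =>
    rw [pow_succ', mul_assoc, ih fun j hj => hp j (by omega),
      mul_integral_div_sub hE hE1 hw (g := fun x => p.eval x * x ^ n) (by fun_prop) hz,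
      hp n (by omega), zero_add]
    simp only [pow_succ, mul_assoc]

theorem cauchyTransform_isBigO (hE : IsCompact E) (hE1 : ∀ x ∈ E, x ≤ 1)
    (hw : IntegrableOn w E) {p : ℝ[X]} {n : ℕ}
    (hp : ∀ j < n, ∫ x in E, p.eval x * x ^ j * w x = 0) :
    cauchyTransform E w p =O[Filter.atTop] fun z => (z ^ (n + 1))⁻¹ := by
  have hint : IntegrableOn (fun x => p.eval x * x ^ n * w x) E :=
    hw.continuousOn_mul (by fun_prop) hE
  apply Asymptotics.IsBigO.of_bound (2 * ∫ x in E, ‖p.eval x * x ^ n * w x‖)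
  filter_upwards [Filter.eventually_ge_atTop 2] with z hz
  have hz0 : 0 < z := by linarith
  have h1 : ‖∫ x in E, p.eval x * x ^ n / (z - x) * w x‖ ≤
      ∫ x in E, (2 / z) * ‖p.eval x * x ^ n * w x‖ := by
    apply norm_integral_le_of_norm_le (hint.norm.const_mul _)
    filter_upwards [ae_restrict_mem hE.measurableSet] with x hx
    have hx1 := hE1 x hx
    rw [div_mul_eq_mul_div, norm_div, Real.norm_of_nonneg (by linarith : 0 ≤ z - x),
      div_le_iff₀ (by linarith)]
    have h3 : 1 ≤ 2 / z * (z - x) := by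
      rw [div_mul_eq_mul_div, le_div_iff₀ hz0]; linarith
    nlinarith [norm_nonneg (p.eval x * x ^ n * w x)]
  rw [← pow_mul_cauchyTransform hE hE1 hw hp (by linarith), integral_const_mul, norm_mul,
    norm_pow, Real.norm_of_nonneg hz0.le] at h1
  rw [norm_inv, norm_pow, Real.norm_of_nonneg hz0.le, ← div_eq_mul_inv, le_div_iff₀ (by positivity),
    pow_succ]
  calc _ = (z ^ n * ‖cauchyTransform E w p z‖) * z := by ring
    _ ≤ (2 / z * ∫ x in E, ‖p.eval x * x ^ n * w x‖) * z := by gcongr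
    _ = _ := by field_simp

/-- Numerator polynomials: the second solution of the three-term recurrence. -/
noncomputable def numeratorPoly (c : ℝ) (a b : ℕ → ℝ) : ℕ → ℝ[X]
  | 0 => 0
  | 1 => C c
  | n + 2 => (X - C (b (n + 2))) * numeratorPoly c a b (n + 1) - C (a (n + 1)) *
      numeratorPoly c a b n

theorem cauchyTransform_eq (hE : IsCompact E) (hE1 : ∀ x ∈ E, x ≤ 1) (hw : IntegrableOn w E)
    (hP0 : P 0 = 1) (horth : ∀ n, 1 ≤ n → ∫ x in E, (P n).eval x * w x = 0)
    (hP1 : P 1 = (X - C (b 1)) * P 0)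
    (hrec : ∀ n, 1 ≤ n →
      P (n + 1) = (X - C (b (n + 1))) * P n - C (a n) * P (n - 1))
    {z : ℝ} (hz : 1 < z) (n : ℕ) :
    cauchyTransform E w (P n) z = (P n).eval z * cauchyTransform E w 1 z -
      (numeratorPoly (∫ x in E, w x) a b n).eval z := by
  induction n using Nat.twoStepInduction with
  | zero => simp [hP0, numeratorPoly]
  | one =>
    have h := cauchyTransform_linear hE hE1 hw (P 0) 0 (b 1) 0 hz
    rw [map_zero, zero_mul, sub_zero, ← hP1] at h
    rw [h, hP1, hP0]
    simp [numeratorPoly]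
  | more n ih1 ih2 =>
    have h := cauchyTransform_linear hE hE1 hw (P (n + 1)) (P n) (b (n + 2)) (a (n + 1)) hz
    have hr := hrec (n + 1) (by omega)
    simp only [Nat.add_sub_cancel, add_assoc, one_add_one_eq_two] at hr
    rw [← hr, horth (n + 1) (by omega), ih1, ih2] at h
    rw [h, hr, numeratorPoly]
    simp only [eval_sub, eval_mul, eval_X, eval_C]
    ring

theorem wronskian_eq {c : ℝ} {k : ℕ → ℝ} (hk0 : k 0 = c) (hk : ∀ n, k (n + 1) = a (n + 1) * k n)
    (hP0 : P 0 = 1) (hrec : ∀ n, 1 ≤ n →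
      P (n + 1) = (X - C (b (n + 1))) * P n - C (a n) * P (n - 1)) (n : ℕ) :
    numeratorPoly c a b (n + 1) * P n - P (n + 1) * numeratorPoly c a b n = C (k n) := by
  induction n with
  | zero => simp [numeratorPoly, hP0, hk0]
  | succ n ih =>
    rw [hrec (n + 1) (by omega), numeratorPoly, hk, C_mul, ← ih, Nat.add_sub_cancel]
    ring

end OrthogonalPolynomials

theorem natDegree_le_of_isBigO_pow {p : ℝ[X]} {k : ℕ}
    (h : (fun z => p.eval z) =O[Filter.atTop] fun z => z ^ k) : p.natDegree ≤ k := by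
  by_contra hlt
  rw [not_le] at hlt
  have hd : (X ^ k : ℝ[X]).degree < p.degree := by
    exact degree_lt_degree (by rwa [natDegree_X_pow])
  have h2 := (isLittleO_atTop_of_degree_lt _ _ hd).trans_isBigO h
  have h3 : (fun z : ℝ => z ^ k) =o[Filter.atTop] fun z : ℝ => z ^ k := by simpa using h2
  have h4 := h3.def (by norm_num : (0 : ℝ) < 1 / 2)
  obtain ⟨z, hz, hz1⟩ := (h4.and (Filter.eventually_gt_atTop 0)).exists
  have : 0 < ‖z ^ k‖ := norm_pos_iff.2 (pow_pos hz1 k).ne'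
  linarith

/-- `√((z - α)(z ^ 2 - 1)(z - β))` agrees with `z ^ 2 - (α + β) / 2 * z` up to a bounded error. -/
theorem sqrt_quartic_isBigO {α β : ℝ} (hα : |α| < 1) (hβ : |β| < 1) :
    (fun z : ℝ => √((z - α) / ((z ^ 2 - 1) * (z - β))) * ((z ^ 2 - 1) * (z - β))
      - (z ^ 2 - (α + β) / 2 * z)) =O[Filter.atTop] fun _ => (1 : ℝ) := by
  rw [abs_lt] at hα hβ
  apply Asymptotics.IsBigO.of_bound 10
  filter_upwards [Filter.eventually_ge_atTop 2] with z hz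
  have hN : 0 < z - α := by linarith
  have hD : 0 < (z ^ 2 - 1) * (z - β) := mul_pos (by nlinarith) (by linarith)
  set N := z - α with hNdef
  set D := (z ^ 2 - 1) * (z - β) with hDdef
  set T := √(N / D) * D with hT
  have hT0 : 0 ≤ T := by positivity
  have hT2 : T ^ 2 = N * D := by
    rw [hT, mul_pow, Real.sq_sqrt (by positivity)]
    field_simp
  set s := (α + β) / 2 with hs
  have hy : z ^ 2 / 2 ≤ z ^ 2 - s * z := by nlinarith
  have hsum : 0 < T + (z ^ 2 - s * z) := by nlinarith
  have hdiff : (T - (z ^ 2 - s * z)) * (T + (z ^ 2 - s * z)) =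
      (α * β - 1 - s ^ 2) * z ^ 2 + 2 * s * z - α * β := by
    have : (T - (z ^ 2 - s * z)) * (T + (z ^ 2 - s * z)) = T ^ 2 - (z ^ 2 - s * z) ^ 2 := by ring
    rw [this, hT2, hNdef, hDdef, hs]
    ring
  have hab : |α * β| ≤ 1 := by
    rw [abs_mul]
    exact mul_le_one₀ (abs_lt.2 hα).le (abs_nonneg _) (abs_lt.2 hβ).le
  have hab' := abs_le.1 hab
  have hs1 : s ^ 2 ≤ 1 := by nlinarith
  rw [norm_one, mul_one, Real.norm_eq_abs, abs_le]
  constructor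
  · by_contra hc
    rw [not_le] at hc
    have h1 : (T - (z ^ 2 - s * z)) * (T + (z ^ 2 - s * z)) < -10 * (T + (z ^ 2 - s * z)) :=
      mul_lt_mul_of_pos_right hc hsum
    nlinarith
  · by_contra hc
    rw [not_le] at hc
    have h1 : 10 * (T + (z ^ 2 - s * z)) < (T - (z ^ 2 - s * z)) * (T + (z ^ 2 - s * z)) :=
      mul_lt_mul_of_pos_right hc hsum
    nlinarith

theorem eval_isBigO_pow (p : ℝ[X]) {n : ℕ} (hp : p.natDegree ≤ n) :
    (fun z => p.eval z) =O[Filter.atTop] fun z => z ^ n := by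
  have := isBigO_atTop_of_degree_le p (X ^ n) (by
    rw [degree_X_pow]; exact natDegree_le_iff_degree_le.1 hp)
  simpa using this

theorem sqrt_ratio_isBigO {α β : ℝ} (hα : |α| < 1) (hβ : |β| < 1) :
    (fun z : ℝ => √((z - α) / ((z ^ 2 - 1) * (z - β)))) =O[Filter.atTop] fun z => z⁻¹ := by
  rw [abs_lt] at hα hβ
  apply Asymptotics.IsBigO.of_bound 3
  filter_upwards [Filter.eventually_ge_atTop 2] with z hz
  have hz0 : 0 < z := by linarith
  have hD : 0 < (z ^ 2 - 1) * (z - β) := mul_pos (by nlinarith) (by linarith)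
  rw [Real.norm_of_nonneg (Real.sqrt_nonneg _), Real.norm_of_nonneg (by positivity)]
  apply Real.sqrt_le_iff.2 ⟨by positivity, ?_⟩
  rw [div_le_iff₀ hD, mul_pow, inv_pow, mul_assoc, inv_mul_eq_div, mul_div_assoc',
    le_div_iff₀ (by positivity)]
  have h1 : 3 / 4 * z ^ 2 ≤ z ^ 2 - 1 := by nlinarith
  have h2 : z / 2 ≤ z - β := by linarith
  have h3 := mul_le_mul h1 h2 (by positivity) (by nlinarith)
  nlinarith [sq_nonneg z, mul_pos hz0 hz0]

/-- The bilinear form in `(P, p)` and `(P', p')` of the Pell-type equation attached to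
`(z - α) / ((z ^ 2 - 1) * (z - β))`. -/
noncomputable def pellForm (α β : ℝ) (P p P' p' : ℝ[X]) : ℝ[X] :=
  P * P' * (X - C α) - p * p' * ((X ^ 2 - 1) * (X - C β))

theorem exists_eval_of_natDegree_le_one {p : ℝ[X]} (hp : p.natDegree ≤ 1) :
    ∃ A B, ∀ x, p.eval x = A * x + B := by
  refine ⟨p.coeff 1, p.coeff 0, fun x => ?_⟩
  conv_lhs => rw [eq_X_add_C_of_natDegree_le_one hp]
  simp

section Asymptotics

variable {α β : ℝ} {P p P' p' : ℝ[X]} {S : ℝ → ℝ} {n : ℕ}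

theorem pell_product_isBigO (hα : |α| < 1) (hβ : |β| < 1)
    (hS : ∀ z, S z = √((z - α) / ((z ^ 2 - 1) * (z - β))))
    {m k : ℕ} (hP : P.natDegree ≤ n)
    (hq : (fun z => P.eval z * S z - p.eval z) =O[Filter.atTop] fun z => (z ^ (n + 1))⁻¹)
    (hq' : (fun z => P'.eval z * S z - p'.eval z) =O[Filter.atTop] fun z => (z ^ (m + 1))⁻¹)
    (hmk : m + k = n + 1) :
    (fun z => (P'.eval z * S z - p'.eval z) * (P.eval z * S z + p.eval z) *
      ((z ^ 2 - 1) * (z - β))) =O[Filter.atTop] fun z => z ^ k := by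
  have hS' : S =O[Filter.atTop] fun z => z⁻¹ := by
    rw [funext hS]; exact sqrt_ratio_isBigO hα hβ
  have hD : (fun z : ℝ => (z ^ 2 - 1) * (z - β)) =O[Filter.atTop] fun z => z ^ 3 := by
    have := eval_isBigO_pow ((X ^ 2 - 1) * (X - C β) : ℝ[X]) (n := 3) (by compute_degree)
    simpa using this
  have hPS := (eval_isBigO_pow P hP).mul hS'
  have hsum : (fun z => P.eval z * S z + p.eval z) =O[Filter.atTop] fun z => z ^ n * z⁻¹ := by
    have hq2 : (fun z => P.eval z * S z - p.eval z) =O[Filter.atTop] fun z => z ^ n * z⁻¹ := by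
      refine hq.trans (Asymptotics.IsBigO.of_bound 1 ?_)
      filter_upwards [Filter.eventually_ge_atTop 1] with z hz
      have hz0 : 0 < z := by linarith
      rw [one_mul, Real.norm_of_nonneg (by positivity), Real.norm_of_nonneg (by positivity),
        pow_succ, mul_inv]
      gcongr
      exact (inv_le_one_of_one_le₀ (one_le_pow₀ hz)).trans (one_le_pow₀ hz)
    refine ((hPS.const_mul_left 2).sub hq2).congr_left fun z => ?_
    ring
  refine ((hq'.mul hsum).mul hD).congr' (Filter.Eventually.of_forall fun z => rfl) ?_
  filter_upwards [Filter.eventually_gt_atTop 0] with z hz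
  have : z ^ (m + k) = z ^ (n + 1) := by rw [hmk]
  rw [pow_add, pow_succ] at this
  rw [pow_succ z m]
  field_simp
  linear_combination -this

theorem sq_mul_eq (hα : |α| < 1) (hβ : |β| < 1)
    (hS : ∀ z, S z = √((z - α) / ((z ^ 2 - 1) * (z - β)))) {z : ℝ} (hz : 1 < z) :
    S z ^ 2 * ((z ^ 2 - 1) * (z - β)) = z - α := by
  rw [abs_lt] at hα hβ
  have hD : 0 < (z ^ 2 - 1) * (z - β) := mul_pos (by nlinarith) (by linarith)
  rw [hS, Real.sq_sqrt (div_nonneg (by linarith) hD.le), div_mul_cancel₀ _ hD.ne']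

theorem exists_eval_pellForm_self (hα : |α| < 1) (hβ : |β| < 1)
    (hS : ∀ z, S z = √((z - α) / ((z ^ 2 - 1) * (z - β)))) (hP : P.natDegree ≤ n)
    (hq : (fun z => P.eval z * S z - p.eval z) =O[Filter.atTop] fun z => (z ^ (n + 1))⁻¹) :
    ∃ A B, ∀ x, (pellForm α β P p P p).eval x = A * x + B := by
  apply exists_eval_of_natDegree_le_one
  apply natDegree_le_of_isBigO_pow
  refine (pell_product_isBigO hα hβ hS hP hq hq rfl).congr' ?_ (by rfl)
  filter_upwards [Filter.eventually_gt_atTop 1] with z hz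
  have := sq_mul_eq hα hβ hS hz
  simp only [pellForm, eval_sub, eval_mul, eval_X, eval_C, eval_pow, eval_one]
  linear_combination P.eval z * P.eval z * this

theorem exists_eval_pellForm_cross (hα : |α| < 1) (hβ : |β| < 1)
    (hS : ∀ z, S z = √((z - α) / ((z ^ 2 - 1) * (z - β)))) (hP : P.natDegree ≤ n)
    (hq : (fun z => P.eval z * S z - p.eval z) =O[Filter.atTop] fun z => (z ^ (n + 1))⁻¹)
    (hq' : (fun z => P'.eval z * S z - p'.eval z) =O[Filter.atTop] fun z => (z ^ (n + 1 + 1))⁻¹)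
    {k : ℝ} (hk : p' * P - P' * p = C k) :
    ∃ d, ∀ x, (pellForm α β P' p' P p).eval x = k * (x ^ 2 - (α + β) / 2 * x) + d := by
  have h1 := pell_product_isBigO (k := 0) hα hβ hS hP hq hq' rfl
  have h2 := ((sqrt_quartic_isBigO hα hβ).const_mul_left k).add (h1.congr_right fun z => pow_zero z)
  have h3 : (pellForm α β P' p' P p - C k * (X ^ 2 - C ((α + β) / 2) * X)).natDegree ≤ 0 := by
    apply natDegree_le_of_isBigO_pow
    refine h2.congr' ?_ (by simp)
    filter_upwards [Filter.eventually_gt_atTop 1] with z hz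
    have h4 := sq_mul_eq hα hβ hS hz
    have h5 := congrArg (eval z) hk
    rw [← hS]
    simp only [pellForm, eval_sub, eval_mul, eval_X, eval_C, eval_pow, eval_one] at h5 ⊢
    linear_combination P'.eval z * P.eval z * h4 - S z * ((z ^ 2 - 1) * (z - β)) * h5
  rw [Nat.le_zero] at h3
  obtain ⟨d, hd⟩ := natDegree_eq_zero.1 h3
  refine ⟨d, fun x => ?_⟩
  rw [← eq_sub_iff_add_eq'.1 hd]
  simp only [eval_add, eval_sub, eval_mul, eval_X, eval_C, eval_pow]

end Asymptotics

/-- first non-linear difference equation for the recurrence coefficients. -/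
theorem recurrence_difference_one
    (α β : ℝ) (hα : (-1:ℝ) < α) (hαβ : α < β) (hβ : β < 1)
    (E : Set ℝ) (hE : E = Set.Icc (-1) α ∪ Set.Icc β 1)
    (w : ℝ → ℝ)
    (hw : ∀ x, w x = (1 / Real.pi) * Real.sqrt ((x - α) / ((1 - x ^ 2) * (x - β))))
    (hw0 : ∀ x ∈ E, 0 ≤ w x)
    (hwint : MeasureTheory.IntegrableOn w E)
    (P : ℕ → Polynomial ℝ) (h : ℕ → ℝ) (a b : ℕ → ℝ)
    (hPmonic : ∀ n, (P n).Monic)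
    (hPdeg : ∀ n, (P n).natDegree = n)
    (hh : ∀ n, 0 < h n)
    (horth : ∀ n m, ∫ x in E, (P n).eval x * (P m).eval x * w x = if n = m then h n else 0)
    (ha : ∀ n, 1 ≤ n → 0 < a n)
    (hrec0 : P 1 = (Polynomial.X - Polynomial.C (b 1)) * P 0)
    (hrec : ∀ n, 1 ≤ n →
      P (n + 1) = (Polynomial.X - Polynomial.C (b (n + 1))) * P n - Polynomial.C (a n) * P (n - 1))
    (n : ℕ) (hn : 3 ≤ n) :
    a n * (b (n + 1) + b n - (α + β) / 2) = a (n - 1) * (b n + b (n - 1) - (α + β) / 2) := by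
  have hα1 : |α| < 1 := abs_lt.2 ⟨hα, by linarith⟩
  have hβ1 : |β| < 1 := abs_lt.2 ⟨by linarith, hβ⟩
  have hEc : IsCompact E := hE ▸ isCompact_Icc.union isCompact_Icc
  have hE1 : ∀ x ∈ E, x ≤ 1 := by
    rw [hE]
    rintro x (hx | hx)
    · linarith [hx.2]
    · exact hx.2
  have hP0 : P 0 = 1 := (hPmonic 0).natDegree_eq_zero.1 (hPdeg 0)
  have horth0 : ∀ n, 1 ≤ n → ∫ x in E, (P n).eval x * w x = 0 := by
    intro n hn
    have := horth n 0
    rw [if_neg (by omega), hP0] at this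
    simpa using this
  have hmass : ∫ x in E, w x = h 0 := by
    have := horth 0 0
    rw [if_pos rfl, hP0] at this
    simpa using this
  set S : ℝ → ℝ := fun z => √((z - α) / ((z ^ 2 - 1) * (z - β))) with hSdef
  have hS : ∀ z, 1 < z → cauchyTransform E w 1 z = S z := by
    intro z hz
    simp only [hSdef]
    rw [← setIntegral_weight_div hα hαβ hβ hz, ← hE, cauchyTransform]
    congr 1
    ext x
    rw [hw, eval_one]
    ring
  set p : ℕ → ℝ[X] := numeratorPoly (h 0) a b with hp
  have hq : ∀ n, (fun z => (P n).eval z * S z - (p n).eval z) =O[Filter.atTop]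
      fun z => (z ^ (n + 1))⁻¹ := by
    intro n
    refine (cauchyTransform_isBigO hEc hE1 hwint (p := P n) (n := n) fun j hj =>
      integral_orthogonal_mul_pow_eq_zero hEc hwint horth0 hrec j n hj).congr' ?_ (by rfl)
    filter_upwards [Filter.eventually_gt_atTop 1] with z hz
    rw [cauchyTransform_eq hEc hE1 hwint hP0 horth0 hrec0 hrec hz, hS z hz, hmass]
  set k : ℕ → ℝ := fun n => n.rec (h 0) fun n x => a (n + 1) * x with hkdef
  have hk : ∀ n, k (n + 1) = a (n + 1) * k n := fun n => rfl
  have hkpos : ∀ n, 0 < k n := by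
    intro n
    induction n with
    | zero => exact hh 0
    | succ n ih => rw [hk]; exact mul_pos (ha _ (by omega)) ih
  choose A B hG using fun n =>
    exists_eval_pellForm_self hα1 hβ1 (fun z => rfl) (hPdeg n).le (hq n)
  choose d hH using fun n => exists_eval_pellForm_cross hα1 hβ1 (fun z => rfl) (hPdeg n).le (hq n)
    (hq (n + 1)) (wronskian_eq (c := h 0) (k := k) rfl hk hP0 hrec n)
  have hPrec : ∀ n, P (n + 2) = (X - C (b (n + 2))) * P (n + 1) - C (a (n + 1)) * P n :=
    fun n => hrec (n + 1) (by omega)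
  have hprec : ∀ n, p (n + 2) = (X - C (b (n + 2))) * p (n + 1) - C (a (n + 1)) * p n :=
    fun n => by rw [hp, numeratorPoly]
  have hrel1 : ∀ n x, k (n + 1) * (x ^ 2 - (α + β) / 2 * x) + d (n + 1) =
      (x - b (n + 2)) * (A (n + 1) * x + B (n + 1)) -
      a (n + 1) * (k n * (x ^ 2 - (α + β) / 2 * x) + d n) := by
    intro n x
    rw [← hH (n + 1) x, ← hH n x, ← hG, show n + 1 + 1 = n + 2 from rfl, hPrec, hprec]
    simp only [pellForm, eval_sub, eval_mul, eval_X, eval_C, eval_pow, eval_one]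
    ring
  have hrel2 : ∀ n x, A (n + 2) * x + B (n + 2) =
      (x - b (n + 2)) * ((k (n + 1) * (x ^ 2 - (α + β) / 2 * x) + d (n + 1)) -
        a (n + 1) * (k n * (x ^ 2 - (α + β) / 2 * x) + d n)) +
      a (n + 1) ^ 2 * (A n * x + B n) := by
    intro n x
    rw [← hH (n + 1) x, ← hH n x, ← hG, ← hG, show n + 1 + 1 = n + 2 from rfl, hPrec, hprec]
    simp only [pellForm, eval_sub, eval_mul, eval_X, eval_C, eval_pow, eval_one]
    ring
  have hA : ∀ n, A (n + 1) = 2 * k (n + 1) := by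
    intro n
    linear_combination -(hrel1 n 1 + hrel1 n (-1)) / 2 + hrel1 n 0 - hk n
  have hB : ∀ n, B (n + 1) = 2 * k (n + 1) * (b (n + 2) - (α + β) / 2) := by
    intro n
    linear_combination -(hrel1 n 1 - hrel1 n (-1)) / 2 + b (n + 2) * hA n + (α + β) / 2 * hk n
  obtain ⟨m, rfl⟩ : ∃ m, n = m + 3 := ⟨n - 3, by omega⟩
  have e1 := hrel2 (m + 1) 1
  have e2 := hrel2 (m + 1) (-1)
  rw [show m + 1 + 2 = m + 2 + 1 from rfl, hA, hB, hA, hB] at e1 e2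
  have k1 := hk (m + 2)
  have k2 := hk (m + 1)
  rw [show m + 2 + 1 = m + 3 from rfl] at *
  rw [show m + 1 + 1 = m + 2 from rfl] at *
  rw [show m + 2 + 2 = m + 4 from rfl, show m + 1 + 2 = m + 3 from rfl] at *
  rw [k1, k2] at e1 e2
  rw [show m + 3 - 1 = m + 2 from rfl, show m + 3 + 1 = m + 4 from rfl]
  have hk1 := (hkpos (m + 1)).ne'
  have ha2 := (ha (m + 2) (by omega)).ne'
  apply mul_left_cancel₀ (mul_ne_zero (mul_ne_zero two_ne_zero hk1) ha2)
  linear_combination (e1 + e2) / 2 + b (m + 3) * (e1 - e2) / 2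
end
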